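/- arXiv:2306.11328 — 3 statements merged into one kernel-verified Lean document; each statement's English description precedes it below -/
import Mathlib

section
/- Let n and t be integers with 0 ≤ t ≤ n−4 such that n−t is even, and let T be a tree of order n with exactly t vertices of degree two that has the minimum Mostar index among all such trees. Then T is isomorphic to C_{n,⌈(n−t)/4 − 1/2⌉,⌊(n−t)/4 − 1/2⌋} (equivalently, C_{n,⌈(n−t−2)/4⌉,⌊(n−t−2)/4⌋}). -/
open Finset SimpleGraph

open scoped Classical

/-- ψ(uv) = |n_u - n_v| for an edge, as a symmetric function on `Sym2 V`. -/
noncomputable def mostarPsi {V : Type*} [Fintype V] (G : SimpleGraph V) : Sym2 V → ℕ :=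
  Sym2.lift ⟨fun u v =>
    (((Finset.univ.filter fun w => G.dist w u < G.dist w v).card : ℤ) -
      ((Finset.univ.filter fun w => G.dist w v < G.dist w u).card : ℤ)).natAbs,
    fun u v => by dsimp only; omega⟩

/-- The Mostar index of a graph. -/
noncomputable def mostar {V : Type*} [Fintype V] (G : SimpleGraph V) : ℕ :=
  ∑ e ∈ G.edgeFinset, mostarPsi G e

/-- The graph on `Fin n` determined by a parent function. -/
def parentGraph (n : ℕ) (p : ℕ → ℕ) : SimpleGraph (Fin n) :=
  SimpleGraph.fromRel (fun u v => p u.val = v.val)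

/-- S_{n,r}: r pendent paths of almost equal lengths at a common vertex. -/
def spiderS (n r : ℕ) : SimpleGraph (Fin n) :=
  parentGraph n (fun v => if v ≤ r then 0 else v - r)

/-- The star on n vertices. -/
def starG (n : ℕ) : SimpleGraph (Fin n) :=
  parentGraph n (fun _ => 0)

/-- C_{n,a,b}. -/
def catC (n a b : ℕ) : SimpleGraph (Fin n) :=
  parentGraph n (fun v =>
    if v < n - a - b then v - 1
    else if v < n - b then v - (n - a - b) + 1
    else v - a - b - 1)

/-- F_{n,a,b}. -/
def catF (n a b : ℕ) : SimpleGraph (Fin n) :=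
  parentGraph n (fun v =>
    if v < n - a - b - 2 then v - 1
    else if v = n - a - b - 2 then 1
    else if v < n - b then v - (n - a - b - 2)
    else v - a - b - 3)

/-- A^r_{n,a,b}. -/
def treeA (n r a b : ℕ) : SimpleGraph (Fin n) :=
  parentGraph n (fun v =>
    if v < n - (a + b) * r then v - 1
    else if v < n - b * r then (if (v - (n - (a + b) * r)) % r = 0 then 0 else v - 1)
    else (if (v - (n - b * r)) % r = 0 then n - (a + b) * r - 1 else v - 1))

/-- S^r_{n,k}: k pendent paths of length r and n - k*r - 1 pendent edges at a common vertex. -/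
def treeSrk (n r k : ℕ) : SimpleGraph (Fin n) :=
  parentGraph n (fun v =>
    if v < n - k * r then 0
    else if (v - (n - k * r)) % r = 0 then 0 else v - 1)

/-- Number of vertices of odd degree. -/
noncomputable def oddDegreeCount {V : Type*} [Fintype V] (G : SimpleGraph V) : ℕ :=
  (Finset.univ.filter fun v => Odd (G.degree v)).card

/-- Number of vertices of degree two. -/
noncomputable def degreeTwoCount {V : Type*} [Fintype V] (G : SimpleGraph V) : ℕ :=
  (Finset.univ.filter fun v => G.degree v = 2).card

/-- Number of branch vertices (degree at least three). -/
noncomputable def branchCount {V : Type*} [Fintype V] (G : SimpleGraph V) : ℕ :=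
  (Finset.univ.filter fun v => 3 ≤ G.degree v).card

/-- Number of pendent paths of length r in G. -/
noncomputable def pendentPathCount {V : Type*} [Fintype V] (G : SimpleGraph V) (r : ℕ) : ℕ :=
  Nat.card { u : Fin (r + 1) → V //
    Function.Injective u ∧
    (∀ i : Fin r, G.Adj (u i.castSucc) (u i.succ)) ∧
    G.degree (u 0) = 1 ∧ 2 ≤ G.degree (u (Fin.last r)) ∧
    ∀ i : Fin (r + 1), i ≠ 0 → i ≠ Fin.last r → G.degree (u i) = 2 }

namespace MT

/-- Rooted structure on a graph: root `c`, parent function `p`, depth function `h`. -/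
structure Rooted {V : Type*} (G : SimpleGraph V) (c : V) (p : V → V) (h : V → ℕ) : Prop where
  pc : p c = c
  hp : ∀ v, v ≠ c → h (p v) + 1 = h v
  adj : ∀ u v, G.Adj u v ↔ (u ≠ c ∧ p u = v) ∨ (v ≠ c ∧ p v = u)

/-- Descendants of `v`. -/
noncomputable def desc {V : Type*} [Fintype V] (p : V → V) (v : V) : Finset V :=
  Finset.univ.filter fun w => ∃ i : ℕ, p^[i] w = v

/-- Children of `v`. -/
noncomputable def ch {V : Type*} [Fintype V] (p : V → V) (c v : V) : Finset V :=
  Finset.univ.filter fun u => u ≠ c ∧ p u = v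

section
variable {V : Type*} [Fintype V] {G : SimpleGraph V} {c : V} {p : V → V} {h : V → ℕ}

theorem mem_desc {v w : V} : w ∈ desc p v ↔ ∃ i : ℕ, p^[i] w = v := by simp [desc]

theorem mem_ch {v u : V} : u ∈ ch p c v ↔ u ≠ c ∧ p u = v := by simp [ch]

theorem desc_self (v : V) : v ∈ desc p v := mem_desc.2 ⟨0, rfl⟩

theorem desc_of_parent {v w : V} (hw : p w ∈ desc p v) : w ∈ desc p v := by
  obtain ⟨i, hi⟩ := mem_desc.1 hw
  exact mem_desc.2 ⟨i + 1, hi⟩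

theorem parent_of_desc {v w : V} (hw : w ∈ desc p v) (hne : w ≠ v) : p w ∈ desc p v := by
  obtain ⟨i, hi⟩ := mem_desc.1 hw
  cases i with
  | zero => exact absurd hi hne
  | succ i => exact mem_desc.2 ⟨i, hi⟩

theorem desc_trans {u v w : V} (h1 : w ∈ desc p v) (h2 : v ∈ desc p u) : w ∈ desc p u := by
  obtain ⟨i, hi⟩ := mem_desc.1 h1
  obtain ⟨j, hj⟩ := mem_desc.1 h2
  exact mem_desc.2 ⟨j + i, by rw [Function.iterate_add_apply, hi, hj]⟩

theorem Rooted.h_parent (R : Rooted G c p h) (v : V) : h (p v) ≤ h v := by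
  by_cases hv : v = c
  · subst hv; rw [R.pc]
  · have := R.hp v hv; omega

theorem Rooted.h_iter (R : Rooted G c p h) (i : ℕ) (v : V) : h (p^[i] v) ≤ h v := by
  induction i generalizing v with
  | zero => exact le_rfl
  | succ i ih => exact (ih (p v)).trans (R.h_parent v)

theorem Rooted.h_desc (R : Rooted G c p h) {v w : V} (hw : w ∈ desc p v) : h v ≤ h w := by
  obtain ⟨i, hi⟩ := mem_desc.1 hw
  rw [← hi]; exact R.h_iter i w

theorem Rooted.iter_c (R : Rooted G c p h) (i : ℕ) : p^[i] c = c := by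
  induction i with
  | zero => rfl
  | succ i ih => rw [Function.iterate_succ_apply, R.pc, ih]

theorem Rooted.h_desc_lt (R : Rooted G c p h) {v w : V} (hw : w ∈ desc p v) (hne : w ≠ v) :
    h v < h w := by
  have hc : w ≠ c := by
    rintro rfl
    obtain ⟨i, hi⟩ := mem_desc.1 hw
    rw [R.iter_c] at hi
    exact hne hi
  have h1 := R.h_desc (parent_of_desc hw hne)
  have h2 := R.hp w hc
  omega

theorem Rooted.desc_c (R : Rooted G c p h) (v : V) : v ∈ desc p c := by
  induction hk : h v using Nat.strong_induction_on generalizing v with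
  | _ k ih =>
    by_cases hv : v = c
    · subst hv; exact desc_self _
    · have := R.hp v hv
      exact desc_of_parent (ih (h (p v)) (by omega) (p v) rfl)

theorem Rooted.mem_desc_child (R : Rooted G c p h) {v w : V} (hw : w ∈ desc p v) (hne : w ≠ v) :
    ∃ u ∈ ch p c v, w ∈ desc p u := by
  obtain ⟨i, hi⟩ := mem_desc.1 hw
  induction i generalizing w with
  | zero => exact absurd hi hne
  | succ i ih =>
    by_cases hpw : p w = v
    · refine ⟨w, mem_ch.2 ⟨?_, hpw⟩, desc_self _⟩
      rintro rfl
      rw [R.pc] at hpw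
      exact hne hpw
    · obtain ⟨u, hu, hu2⟩ := ih (parent_of_desc hw hne) hpw hi
      exact ⟨u, hu, desc_of_parent hu2⟩

theorem desc_total {u v w : V} (h1 : w ∈ desc p u) (h2 : w ∈ desc p v) :
    u ∈ desc p v ∨ v ∈ desc p u := by
  obtain ⟨i, hi⟩ := mem_desc.1 h1
  obtain ⟨j, hj⟩ := mem_desc.1 h2
  rcases le_total i j with hij | hij
  · left
    refine mem_desc.2 ⟨j - i, ?_⟩
    rw [← hi, ← Function.iterate_add_apply, Nat.sub_add_cancel hij, hj]
  · right
    refine mem_desc.2 ⟨i - j, ?_⟩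
    rw [← hj, ← Function.iterate_add_apply, Nat.sub_add_cancel hij, hi]

theorem Rooted.h_ch (R : Rooted G c p h) {v u : V} (hu : u ∈ ch p c v) : h u = h v + 1 := by
  obtain ⟨h1, h2⟩ := mem_ch.1 hu
  rw [← R.hp u h1, h2]

theorem Rooted.ch_disjoint (R : Rooted G c p h) {v u u' w : V} (hu : u ∈ ch p c v)
    (hu' : u' ∈ ch p c v) (h1 : w ∈ desc p u) (h2 : w ∈ desc p u') : u = u' := by
  by_contra hne
  have e1 := R.h_ch hu
  have e2 := R.h_ch hu'
  rcases desc_total h1 h2 with h3 | h3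
  · have := R.h_desc_lt h3 hne; omega
  · have := R.h_desc_lt h3 (Ne.symm hne); omega

theorem Rooted.ch_not_desc (R : Rooted G c p h) {v u : V} (hu : u ∈ ch p c v) :
    v ∉ desc p u := by
  intro hv
  have e1 := R.h_ch hu
  have := R.h_desc hv
  omega

theorem ch_desc {v u : V} (hu : u ∈ ch p c v) : u ∈ desc p v := by
  apply desc_of_parent
  rw [(mem_ch.1 hu).2]
  exact desc_self v

theorem Rooted.desc_eq (R : Rooted G c p h) (v : V) :
    desc p v = insert v ((ch p c v).biUnion (desc p)) := by
  ext w
  simp only [Finset.mem_insert, Finset.mem_biUnion]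
  constructor
  · intro hw
    by_cases hne : w = v
    · exact Or.inl hne
    · exact Or.inr (R.mem_desc_child hw hne)
  · rintro (rfl | ⟨u, hu, hw⟩)
    · exact desc_self _
    · exact desc_trans hw (ch_desc hu)

theorem Rooted.sum_desc (R : Rooted G c p h) (v : V) (F : V → ℤ) :
    ∑ w ∈ desc p v, F w = F v + ∑ u ∈ ch p c v, ∑ w ∈ desc p u, F w := by
  rw [R.desc_eq v, Finset.sum_insert, Finset.sum_biUnion]
  · intro u hu u' hu' hne
    simp only [Function.onFun]
    rw [Finset.disjoint_left]
    intro w hw hw'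
    exact hne (R.ch_disjoint hu hu' hw hw')
  · simp only [Finset.mem_biUnion, not_exists, not_and]
    intro u hu
    exact R.ch_not_desc hu

/-- number of descendants -/
noncomputable def sz (p : V → V) (v : V) : ℤ := ((desc p v).card : ℤ)

theorem Rooted.sz_eq (R : Rooted G c p h) (v : V) :
    sz p v = 1 + ∑ u ∈ ch p c v, sz p u := by
  have := R.sum_desc v (fun _ => 1)
  simpa [sz] using this

theorem sz_pos (v : V) : 1 ≤ sz p v := by
  unfold sz
  have : 0 < (desc p v).card := Finset.card_pos.2 ⟨v, desc_self v⟩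
  exact_mod_cast this

theorem sz_mono {u v : V} (huv : u ∈ desc p v) : sz p u ≤ sz p v := by
  unfold sz
  exact_mod_cast Finset.card_le_card (fun w hw => desc_trans hw huv)

theorem Rooted.sz_c (R : Rooted G c p h) : sz p c = Fintype.card V := by
  unfold sz
  rw [← Finset.card_univ]
  congr 2
  ext w
  simp [R.desc_c]

theorem Rooted.adj_parent (R : Rooted G c p h) {v : V} (hv : v ≠ c) : G.Adj v (p v) :=
  (R.adj _ _).2 (Or.inl ⟨hv, rfl⟩)

theorem Rooted.connected (R : Rooted G c p h) : G.Connected := by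
  have key : ∀ v, G.Reachable v c := by
    intro v
    induction hk : h v using Nat.strong_induction_on generalizing v with
    | _ k ih =>
      by_cases hv : v = c
      · subst hv; exact Reachable.refl _
      · have := R.hp v hv
        exact (R.adj_parent hv).reachable.trans (ih (h (p v)) (by omega) (p v) rfl)
  haveI : Nonempty V := ⟨c⟩
  exact ⟨fun u v => (key u).trans (key v).symm⟩

/-- the only edge leaving `desc v` is the edge from `v` to its parent -/
theorem Rooted.boundary (R : Rooted G c p h) {v a b : V} (ha : a ∈ desc p v)
    (hb : b ∉ desc p v) (hab : G.Adj a b) : a = v ∧ b = p v := by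
  rcases (R.adj a b).1 hab with ⟨_, h2⟩ | ⟨_, h2⟩
  · by_cases hav : a = v
    · exact ⟨hav, by rw [← hav, h2]⟩
    · exact absurd (h2 ▸ parent_of_desc ha hav) hb
  · exact absurd (desc_of_parent (h2 ▸ ha)) hb

theorem Rooted.dist_cross (R : Rooted G c p h) {v a b : V} (w : G.Walk a b) :
    (a ∈ desc p v → b ∉ desc p v → G.dist a v + 1 ≤ w.length) := by
  induction w with
  | nil => intro h1 h2; exact absurd h1 h2
  | @cons a a' b hadj q ih =>
    intro h1 h2
    rw [Walk.length_cons]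
    by_cases h3 : a' ∈ desc p v
    · have := ih h3 h2
      have h4 := R.connected.dist_triangle (u := a) (v := a') (w := v)
      rw [dist_eq_one_iff_adj.2 hadj] at h4
      omega
    · obtain ⟨rfl, -⟩ := R.boundary h1 h3 hadj
      simp

theorem Rooted.dist_cross' (R : Rooted G c p h) {v a b : V} (w : G.Walk a b) :
    (a ∉ desc p v → b ∈ desc p v → G.dist a (p v) + 1 ≤ w.length) := by
  induction w with
  | nil => intro h1 h2; exact absurd h2 h1
  | @cons a a' b hadj q ih =>
    intro h1 h2
    rw [Walk.length_cons]
    by_cases h3 : a' ∈ desc p v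
    · obtain ⟨-, h4⟩ := R.boundary h3 h1 hadj.symm
      rw [← h4]
      simp
    · have := ih h3 h2
      have h4 := R.connected.dist_triangle (u := a) (v := a') (w := p v)
      rw [dist_eq_one_iff_adj.2 hadj] at h4
      omega

theorem Rooted.p_not_desc (R : Rooted G c p h) {v : V} (hv : v ≠ c) : p v ∉ desc p v := by
  intro h1
  have := R.h_desc h1
  have := R.hp v hv
  omega

theorem Rooted.dist_in (R : Rooted G c p h) {v w : V} (hv : v ≠ c) (hw : w ∈ desc p v) :
    G.dist w (p v) = G.dist w v + 1 := by
  obtain ⟨q, hq⟩ := R.connected.exists_walk_length_eq_dist w (p v)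
  have h1 := R.dist_cross q hw (R.p_not_desc hv)
  have h4 := R.connected.dist_triangle (u := w) (v := v) (w := p v)
  rw [dist_eq_one_iff_adj.2 (R.adj_parent hv)] at h4
  omega

theorem Rooted.dist_out (R : Rooted G c p h) {v w : V} (hv : v ≠ c) (hw : w ∉ desc p v) :
    G.dist w v = G.dist w (p v) + 1 := by
  obtain ⟨q, hq⟩ := R.connected.exists_walk_length_eq_dist w v
  have h1 := R.dist_cross' q hw (desc_self v)
  have h4 := R.connected.dist_triangle (u := w) (v := p v) (w := v)
  rw [dist_eq_one_iff_adj.2 (R.adj_parent hv).symm] at h4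
  omega

theorem Rooted.psi (R : Rooted G c p h) {v : V} (hv : v ≠ c) :
    (mostarPsi G s(v, p v) : ℤ) = |(Fintype.card V : ℤ) - 2 * sz p v| := by
  have e1 : (Finset.univ.filter fun w => G.dist w v < G.dist w (p v)) = desc p v := by
    ext w
    simp only [Finset.mem_filter, Finset.mem_univ, true_and]
    by_cases hw : w ∈ desc p v
    · have := R.dist_in hv hw
      simp only [hw, iff_true]; omega
    · have := R.dist_out hv hw
      simp only [hw, iff_false]; omega
  have e2 : (Finset.univ.filter fun w => G.dist w (p v) < G.dist w v) = (desc p v)ᶜ := by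
    ext w
    simp only [Finset.mem_filter, Finset.mem_univ, true_and, Finset.mem_compl]
    by_cases hw : w ∈ desc p v
    · have := R.dist_in hv hw
      simp only [hw, not_true_eq_false, iff_false]; omega
    · have := R.dist_out hv hw
      simp only [hw, not_false_eq_true, iff_true]; omega
  have e3 : mostarPsi G s(v, p v) = (((desc p v).card : ℤ) - (((desc p v)ᶜ).card : ℤ)).natAbs := by
    simp only [mostarPsi, Sym2.lift_mk]
    rw [e1, e2]
  rw [e3, Finset.card_compl, Nat.cast_sub (Finset.card_le_univ _), Int.natCast_natAbs, abs_sub_comm]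
  congr 1
  unfold sz
  ring

theorem Rooted.parent_inj (R : Rooted G c p h) {u v : V} (hu : u ≠ c) (hv : v ≠ c)
    (he : s(u, p u) = s(v, p v)) : u = v := by
  rw [Sym2.eq_iff] at he
  rcases he with ⟨h1, _⟩ | ⟨h1, h2⟩
  · exact h1
  · have e1 := R.hp u hu
    have e2 := R.hp v hv
    rw [h2] at e1
    rw [← h1] at e2
    omega

theorem Rooted.edges (R : Rooted G c p h) :
    G.edgeFinset = (Finset.univ.erase c).image (fun v => s(v, p v)) := by
  ext e
  induction e using Sym2.ind with
  | _ u v =>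
    simp only [mem_edgeFinset, mem_edgeSet, Finset.mem_image, Finset.mem_erase, Finset.mem_univ,
      and_true]
    rw [R.adj]
    constructor
    · rintro (⟨h1, h2⟩ | ⟨h1, h2⟩)
      · exact ⟨u, h1, by rw [h2]⟩
      · exact ⟨v, h1, by rw [h2, Sym2.eq_swap]⟩
    · rintro ⟨w, h1, h2⟩
      rw [Sym2.eq_iff] at h2
      rcases h2 with ⟨rfl, h3⟩ | ⟨rfl, h3⟩
      · exact Or.inl ⟨h1, h3⟩
      · exact Or.inr ⟨h1, h3⟩

theorem Rooted.mostar_eq (R : Rooted G c p h) :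
    (mostar G : ℤ) = ∑ v ∈ Finset.univ.erase c, |(Fintype.card V : ℤ) - 2 * sz p v| := by
  unfold mostar
  rw [R.edges, Finset.sum_image]
  · push_cast
    exact Finset.sum_congr rfl fun v hv => R.psi (Finset.ne_of_mem_erase hv)
  · intro u hu v hv he
    exact R.parent_inj (Finset.ne_of_mem_erase hu) (Finset.ne_of_mem_erase hv) he

theorem Rooted.card_edges (R : Rooted G c p h) : G.edgeFinset.card + 1 = Fintype.card V := by
  rw [R.edges, Finset.card_image_of_injOn, Finset.card_erase_of_mem (Finset.mem_univ c),
    Finset.card_univ]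
  · have : 0 < Fintype.card V := Fintype.card_pos_iff.2 ⟨c⟩
    omega
  · intro u hu v hv he
    exact R.parent_inj (Finset.ne_of_mem_erase hu) (Finset.ne_of_mem_erase hv) he

theorem Rooted.isTree (R : Rooted G c p h) : G.IsTree := by
  rw [isTree_iff_connected_and_card]
  refine ⟨R.connected, ?_⟩
  rw [Nat.card_eq_fintype_card, Nat.card_eq_fintype_card, ← R.card_edges, edgeFinset_card]

/-- every tree can be rooted anywhere -/
theorem exists_rooted (hT : G.IsTree) (c : V) : ∃ p h, Rooted G c p h := by
  have hex : ∀ v, ∃ u, v ≠ c → G.Adj v u ∧ G.dist u c + 1 = G.dist v c := by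
    intro v
    by_cases hv : v = c
    · exact ⟨v, fun h => absurd hv h⟩
    · obtain ⟨q, hq⟩ := hT.connected.exists_walk_length_eq_dist v c
      cases q with
      | nil => exact absurd rfl hv
      | @cons _ u _ hadj q =>
        refine ⟨u, fun _ => ⟨hadj, ?_⟩⟩
        rw [Walk.length_cons] at hq
        have h1 := dist_le q
        have h4 := hT.connected.dist_triangle (u := v) (v := u) (w := c)
        rw [dist_eq_one_iff_adj.2 hadj] at h4
        omega
  choose p0 hp0 using hex
  let p : V → V := fun v => if v = c then c else p0 v
  have hpv : ∀ v, v ≠ c → p v = p0 v := fun v hv => by simp [p, hv]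
  have hh : ∀ v, v ≠ c → G.dist (p v) c + 1 = G.dist v c := fun v hv => by
    rw [hpv v hv]; exact (hp0 v hv).2
  have hadj : ∀ v, v ≠ c → G.Adj v (p v) := fun v hv => by
    rw [hpv v hv]; exact (hp0 v hv).1
  have hinj : ∀ u v, u ≠ c → v ≠ c → s(u, p u) = s(v, p v) → u = v := by
    intro u v hu hv he
    rw [Sym2.eq_iff] at he
    rcases he with ⟨h1, _⟩ | ⟨h1, h2⟩
    · exact h1
    · have e1 := hh u hu
      have e2 := hh v hv
      rw [h2] at e1
      rw [← h1] at e2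
      omega
  have hsub : (Finset.univ.erase c).image (fun v => s(v, p v)) ⊆ G.edgeFinset := by
    intro e he
    simp only [Finset.mem_image, Finset.mem_erase, Finset.mem_univ, and_true] at he
    obtain ⟨v, hv, rfl⟩ := he
    rw [mem_edgeFinset, mem_edgeSet]
    exact hadj v hv
  have hcard : G.edgeFinset.card + 1 = Fintype.card V := hT.card_edgeFinset
  have hcard2 : ((Finset.univ.erase c).image (fun v => s(v, p v))).card + 1 = Fintype.card V := by
    rw [Finset.card_image_of_injOn, Finset.card_erase_of_mem (Finset.mem_univ c),
      Finset.card_univ]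
    · have : 0 < Fintype.card V := Fintype.card_pos_iff.2 ⟨c⟩
      omega
    · intro u hu v hv he
      exact hinj u v (Finset.ne_of_mem_erase hu) (Finset.ne_of_mem_erase hv) he
  have heq := Finset.eq_of_subset_of_card_le hsub (by omega)
  refine ⟨p, fun v => G.dist v c, ⟨by simp [p], hh, ?_⟩⟩
  intro u v
  constructor
  · intro huv
    have : s(u, v) ∈ G.edgeFinset := by rw [mem_edgeFinset, mem_edgeSet]; exact huv
    rw [← heq] at this
    simp only [Finset.mem_image, Finset.mem_erase, Finset.mem_univ, and_true] at this
    obtain ⟨w, h1, h2⟩ := this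
    rw [Sym2.eq_iff] at h2
    rcases h2 with ⟨rfl, h3⟩ | ⟨rfl, h3⟩
    · exact Or.inl ⟨h1, h3⟩
    · exact Or.inr ⟨h1, h3⟩
  · rintro (⟨h1, h2⟩ | ⟨h1, h2⟩)
    · rw [← h2]; exact hadj u h1
    · rw [← h2]; exact (hadj v h1).symm

/-- existence of a centroid -/
theorem exists_centroid [Nonempty V] (hT : G.IsTree) :
    ∃ c p h, Rooted G c p h ∧ ∀ v, v ≠ c → 2 * sz p v ≤ Fintype.card V := by
  obtain ⟨c, -, hc⟩ := Finset.exists_min_image (Finset.univ : Finset V)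
    (fun c => ∑ w, (G.dist w c : ℤ)) ⟨Classical.arbitrary V, Finset.mem_univ _⟩
  obtain ⟨p, h, R⟩ := exists_rooted hT c
  refine ⟨c, p, h, R, ?_⟩
  have key : ∀ u ∈ ch p c c, 2 * sz p u ≤ Fintype.card V := by
    intro u hu
    obtain ⟨hu1, hu2⟩ := mem_ch.1 hu
    have hmin := hc u (Finset.mem_univ _)
    have hsum : ∑ w, (G.dist w u : ℤ) = ∑ w, (G.dist w c : ℤ) + Fintype.card V - 2 * sz p u := by
      have e : ∀ w, (G.dist w u : ℤ) = (G.dist w c : ℤ) + 1 - 2 * (if w ∈ desc p u then 1 else 0) := by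
        intro w
        by_cases hw : w ∈ desc p u
        · have := R.dist_in hu1 hw
          rw [hu2] at this
          simp only [hw, if_true]; omega
        · have := R.dist_out hu1 hw
          rw [hu2] at this
          simp only [hw, if_false]; omega
      rw [Finset.sum_congr rfl (fun w _ => e w), Finset.sum_sub_distrib, Finset.sum_add_distrib,
        ← Finset.mul_sum]
      simp [sz]
    linarith
  intro v hv
  obtain ⟨u, hu, hvu⟩ := R.mem_desc_child (R.desc_c v) hv
  have := key u hu
  have := sz_mono hvu
  linarith

theorem Rooted.degree_eq (R : Rooted G c p h) {v : V} (hv : v ≠ c) :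
    G.degree v = (ch p c v).card + 1 := by
  rw [← card_neighborFinset_eq_degree]
  have : G.neighborFinset v = insert (p v) (ch p c v) := by
    ext w
    rw [mem_neighborFinset, R.adj, Finset.mem_insert, mem_ch]
    constructor
    · rintro (⟨_, h1⟩ | h1)
      · exact Or.inl h1.symm
      · exact Or.inr h1
    · rintro (h1 | h1)
      · exact Or.inl ⟨hv, h1.symm⟩
      · exact Or.inr h1
  rw [this, Finset.card_insert_of_notMem]
  intro hm
  have := R.h_ch hm
  have := R.hp v hv
  omega

theorem Rooted.degree_c (R : Rooted G c p h) : G.degree c = (ch p c c).card := by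
  rw [← card_neighborFinset_eq_degree]
  congr 1
  ext w
  rw [mem_neighborFinset, R.adj, mem_ch]
  simp

end

/-- The branch bound. -/
def bb (s e : ℤ) : ℤ := 2 * s * (s + 1) - (e - 1) ^ 2

theorem bin_bound {s e D s' e' D' : ℤ} (he : 1 ≤ e) (hs : e ≤ s) (he' : 1 ≤ e') (hs' : e' ≤ s')
    (hD : 4 * D ≤ bb s e) (hD' : 4 * D' ≤ bb s' e') :
    4 * (D + D') ≤ 2 * (s + s') * (s + s' + 1) - (e + e') ^ 2 ∧
    (4 * (D + D') = 2 * (s + s') * (s + s' + 1) - (e + e') ^ 2 →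
      s = e ∧ s' = e' ∧ (e = 1 ∨ e' = 1) ∧ 4 * D = bb s e ∧ 4 * D' = bb s' e') := by
  unfold bb at *
  have h1 : 0 ≤ (s - e) * s' := mul_nonneg (by linarith) (by linarith)
  have h2 : 0 ≤ (s' - e') * e := mul_nonneg (by linarith) (by linarith)
  have h3 : 0 ≤ (e - 1) * (e' - 1) := mul_nonneg (by linarith) (by linarith)
  refine ⟨by nlinarith, fun h => ?_⟩
  have k1 : (s - e) * s' = 0 := by nlinarith
  have k2 : (s' - e') * e = 0 := by nlinarith
  have k3 : (e - 1) * (e' - 1) = 0 := by nlinarith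
  have a1 : s = e := by
    rcases mul_eq_zero.1 k1 with h | h <;> linarith
  have a2 : s' = e' := by
    rcases mul_eq_zero.1 k2 with h | h <;> linarith
  refine ⟨a1, a2, ?_, by nlinarith, by nlinarith⟩
  rcases mul_eq_zero.1 k3 with h | h
  · left; linarith
  · right; linarith

section
variable {ι : Type*} {s e D : ι → ℤ}

theorem group_one (I : Finset ι)
    (hI : ∀ i ∈ I, 1 ≤ e i ∧ e i ≤ s i ∧ 4 * D i ≤ bb (s i) (e i)) (hne : I.Nonempty) :
    1 ≤ ∑ i ∈ I, e i ∧ ∑ i ∈ I, e i ≤ ∑ i ∈ I, s i ∧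
      4 * ∑ i ∈ I, D i ≤ bb (∑ i ∈ I, s i) (∑ i ∈ I, e i) := by
  induction hne using Finset.Nonempty.cons_induction with
  | singleton a => simpa using hI a (by simp)
  | cons a I ha hne ih =>
    have h1 := hI a (by simp)
    have h2 := ih (fun i hi => hI i (by simp [hi]))
    have h3 := (bin_bound h1.1 h1.2.1 h2.1 h2.2.1 h1.2.2 h2.2.2).1
    rw [Finset.sum_cons, Finset.sum_cons, Finset.sum_cons]
    refine ⟨by linarith, by linarith, ?_⟩
    unfold bb
    nlinarith

theorem group_two (I : Finset ι)
    (hI : ∀ i ∈ I, 1 ≤ e i ∧ e i ≤ s i ∧ 4 * D i ≤ bb (s i) (e i)) (hne : 2 ≤ I.card) :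
    2 ≤ ∑ i ∈ I, e i ∧ 4 * ∑ i ∈ I, D i ≤
      2 * (∑ i ∈ I, s i) * (∑ i ∈ I, s i + 1) - (∑ i ∈ I, e i) ^ 2 := by
  obtain ⟨a, ha⟩ := Finset.card_pos.1 (by omega : 0 < I.card)
  have hc : 0 < (I.erase a).card := by rw [Finset.card_erase_of_mem ha]; omega
  have h1 := hI a ha
  have h2 := group_one (I.erase a) (fun i hi => hI i (Finset.mem_of_mem_erase hi))
    (Finset.card_pos.1 hc)
  rw [← Finset.add_sum_erase I _ ha, ← Finset.add_sum_erase I _ ha, ← Finset.add_sum_erase I _ ha]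
  exact ⟨by linarith, (bin_bound h1.1 h1.2.1 h2.1 h2.2.1 h1.2.2 h2.2.2).1⟩

theorem group_three (I : Finset ι)
    (hI : ∀ i ∈ I, 1 ≤ e i ∧ e i ≤ s i ∧ 4 * D i ≤ bb (s i) (e i)) (hne : 3 ≤ I.card) :
    4 * ∑ i ∈ I, D i <
      2 * (∑ i ∈ I, s i) * (∑ i ∈ I, s i + 1) - (∑ i ∈ I, e i) ^ 2 := by
  obtain ⟨a, ha⟩ := Finset.card_pos.1 (by omega : 0 < I.card)
  have hc : 2 ≤ (I.erase a).card := by rw [Finset.card_erase_of_mem ha]; omega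
  have hJ : ∀ i ∈ I.erase a, 1 ≤ e i ∧ e i ≤ s i ∧ 4 * D i ≤ bb (s i) (e i) :=
    fun i hi => hI i (Finset.mem_of_mem_erase hi)
  obtain ⟨h1, h1', h1''⟩ := hI a ha
  obtain ⟨h2, h2'⟩ := group_two (I.erase a) hJ hc
  obtain ⟨-, h3, -⟩ := group_one (I.erase a) hJ (Finset.card_pos.1 (by omega))
  rw [← Finset.add_sum_erase I _ ha, ← Finset.add_sum_erase I _ ha, ← Finset.add_sum_erase I _ ha]
  generalize ∑ i ∈ I.erase a, e i = E at *
  generalize ∑ i ∈ I.erase a, s i = S at *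
  generalize ∑ i ∈ I.erase a, D i = DD at *
  unfold bb at *
  have k1 : 0 ≤ (s a - e a) * S := mul_nonneg (by linarith) (by linarith)
  have k2 : 0 ≤ (S - E) * e a := mul_nonneg (by linarith) (by linarith)
  have k3 : 0 ≤ (e a) * (E - 1) := mul_nonneg (by linarith) (by linarith)
  nlinarith

/-- Equality analysis for a group with at least two members. -/
theorem group_eq (I : Finset ι)
    (hI : ∀ i ∈ I, 1 ≤ e i ∧ e i ≤ s i ∧ 4 * D i ≤ bb (s i) (e i)) (hne : 2 ≤ I.card)
    (heq : 4 * ∑ i ∈ I, D i =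
      2 * (∑ i ∈ I, s i) * (∑ i ∈ I, s i + 1) - (∑ i ∈ I, e i) ^ 2) :
    ∃ u w, u ≠ w ∧ I = {u, w} ∧ s u = e u ∧ s w = e w ∧ e w = 1 ∧
      4 * D u = bb (s u) (e u) := by
  have h3 : I.card = 2 := by
    by_contra hc
    have := group_three I hI (by omega)
    linarith
  obtain ⟨u, w, huw, rfl⟩ := Finset.card_eq_two.1 h3
  rw [Finset.sum_pair huw, Finset.sum_pair huw, Finset.sum_pair huw] at heq
  obtain ⟨h1, h1', h1''⟩ := hI u (by simp)
  obtain ⟨h2, h2', h2''⟩ := hI w (by simp)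
  obtain ⟨a1, a2, a3, a4, a5⟩ := (bin_bound h1 h1' h2 h2' h1'' h2'').2 heq
  rcases a3 with a3 | a3
  · exact ⟨w, u, huw.symm, Finset.pair_comm _ _, a2, a1, a3, a5⟩
  · exact ⟨u, w, huw, rfl, a1, a2, a3, a4⟩

end

section
variable {V : Type*} [Fintype V] {G : SimpleGraph V} {c : V} {p : V → V} {h : V → ℕ}

/-- number of descendants of degree two -/
noncomputable def tt (G : SimpleGraph V) (p : V → V) (v : V) : ℤ :=
  ∑ w ∈ desc p v, (if G.degree w = 2 then 1 else 0)

/-- sum of sizes over descendants -/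
noncomputable def dd (p : V → V) (v : V) : ℤ := ∑ w ∈ desc p v, sz p w

/-- A path downwards from `v` with `τ` vertices without pendants followed by `b` with pendants. -/
def Chain (p : V → V) (c : V) (M : Set V) (v : V) (τ b : ℕ) : Prop :=
  ∃ x y : ℕ → V, x 0 = v ∧ (∀ i < τ + b, x (i + 1) ≠ c ∧ p (x (i + 1)) = x i) ∧
    (∀ i < b, y i ≠ c ∧ p (y i) = x (τ + i) ∧ y i ≠ x (τ + i + 1)) ∧
    (∀ i ≤ τ + b, x i ∈ M) ∧ (∀ i < b, y i ∈ M)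

theorem chain_leaf {M : Set V} {v : V} (hv : v ∈ M) : Chain p c M v 0 0 :=
  ⟨fun _ => v, fun _ => v, rfl, by simp, by simp, by simpa, by simp⟩

theorem chain_one {M M' : Set V} {u v : V} {τ b : ℕ} (hc : Chain p c M u τ b) (hM : M ⊆ M')
    (hv : v ∈ M') (hu : u ≠ c) (huv : p u = v) : Chain p c M' v (τ + 1) b := by
  obtain ⟨x, y, h0, h1, h2, h3, h4⟩ := hc
  refine ⟨fun i => if i = 0 then v else x (i - 1), y, rfl, ?_, ?_, ?_, ?_⟩
  · intro i hi
    rcases i with _ | i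
    · simp [h0, hu, huv]
    · simpa using h1 i (by omega)
  · intro i hi
    have := h2 i hi
    have e1 : τ + 1 + i ≠ 0 := by omega
    have e2 : τ + 1 + i - 1 = τ + i := by omega
    simp only [e1, if_false, e2]
    have e3 : τ + 1 + i + 1 - 1 = τ + i + 1 := by omega
    simpa [e3] using this
  · intro i hi
    rcases i with _ | i
    · simpa using hv
    · simpa using hM (h3 i (by omega))
  · intro i hi
    exact hM (h4 i hi)

theorem chain_two {M M' : Set V} {u v w : V} {b : ℕ} (hc : Chain p c M u 0 b) (hM : M ⊆ M')
    (hv : v ∈ M') (hu : u ≠ c) (huv : p u = v) (hw : w ≠ c) (hwv : p w = v) (hne : w ≠ u)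
    (hwM : w ∈ M') : Chain p c M' v 0 (b + 1) := by
  obtain ⟨x, y, h0, h1, h2, h3, h4⟩ := hc
  refine ⟨fun i => if i = 0 then v else x (i - 1), fun i => if i = 0 then w else y (i - 1),
    rfl, ?_, ?_, ?_, ?_⟩
  · intro i hi
    rcases i with _ | i
    · simp [h0, hu, huv]
    · simpa using h1 i (by omega)
  · intro i hi
    rcases i with _ | i
    · simp [hw, hwv, h0, hne]
    · simpa using h2 i (by omega)
  · intro i hi
    rcases i with _ | i
    · simpa using hv
    · simpa using hM (h3 i (by omega))
  · intro i hi
    rcases i with _ | i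
    · simpa using hwM
    · simpa using hM (h4 i (by omega))

theorem tt_nonneg (v : V) : 0 ≤ tt G p v :=
  Finset.sum_nonneg (fun w _ => by split_ifs <;> norm_num)

theorem Rooted.tt_eq (R : Rooted G c p h) (v : V) :
    tt G p v = (if G.degree v = 2 then 1 else 0) + ∑ u ∈ ch p c v, tt G p u :=
  R.sum_desc v _

theorem Rooted.dd_eq (R : Rooted G c p h) (v : V) :
    dd p v = sz p v + ∑ u ∈ ch p c v, dd p u :=
  R.sum_desc v _

/-- the branch claim -/
def BC (G : SimpleGraph V) (c : V) (p : V → V) (v : V) : Prop :=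
  1 ≤ sz p v - tt G p v ∧ 4 * dd p v ≤ bb (sz p v) (sz p v - tt G p v) ∧
    (4 * dd p v = bb (sz p v) (sz p v - tt G p v) →
      ∃ τ b : ℕ, Chain p c (desc p v : Set V) v τ b ∧ tt G p v = τ ∧ sz p v = τ + 2 * b + 1)

theorem Rooted.ch_sz_lt (R : Rooted G c p h) {u v : V} (hu : u ∈ ch p c v) : sz p u < sz p v := by
  rw [R.sz_eq v]
  have := Finset.single_le_sum (f := fun u => sz p u) (s := ch p c v)
    (fun i _ => by have := sz_pos (p := p) i; linarith) hu
  linarith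

theorem Rooted.branch (R : Rooted G c p h) : ∀ (k : ℕ) (v : V), sz p v ≤ k → v ≠ c →
    BC G c p v := by
  intro k
  induction k with
  | zero => intro v hv; have := sz_pos (p := p) v; push_cast at hv; linarith
  | succ k ih =>
  intro v hk hv
  have hch : ∀ u ∈ ch p c v, BC G c p u := fun u hu => by
    have h1 := R.ch_sz_lt hu
    exact ih u (by push_cast at hk; linarith) (mem_ch.1 hu).1
  have hdesc : ∀ u ∈ ch p c v, (desc p u : Set V) ⊆ desc p v := by
    intro u hu w hw
    exact desc_trans hw (ch_desc hu)
  have hs := R.sz_eq v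
  have ht := R.tt_eq v
  have hd := R.dd_eq v
  have hdeg := R.degree_eq hv
  have hvd : v ∈ (desc p v : Set V) := desc_self v
  rcases Nat.lt_or_ge (ch p c v).card 2 with hlt | hge
  · rcases (by omega : (ch p c v).card = 0 ∨ (ch p c v).card = 1) with h0 | h1
    · rw [Finset.card_eq_zero] at h0
      rw [h0] at hs ht hd hdeg
      simp only [Finset.card_empty] at hdeg
      rw [hdeg] at ht
      simp only [Finset.sum_empty] at hs ht hd
      norm_num at ht hs
      rw [hs] at hd
      unfold BC bb
      rw [hs, ht, hd]
      refine ⟨by norm_num, by norm_num, fun _ => ⟨0, 0, chain_leaf hvd, by simp, by simp⟩⟩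
    · have hdeg2 : G.degree v = 2 := by rw [hdeg, h1]
      obtain ⟨u, hu⟩ := Finset.card_eq_one.1 h1
      have humem : u ∈ ch p c v := by rw [hu]; simp
      rw [hu] at hs ht hd
      rw [hdeg2] at ht
      simp only [Finset.sum_singleton, if_true] at hs ht hd
      obtain ⟨b1, b2, b3⟩ := hch u humem
      unfold bb at b2 b3
      unfold BC bb
      have he : sz p v - tt G p v = sz p u - tt G p u := by linarith
      rw [he]
      have hs' : sz p u = sz p v - 1 := by linarith
      refine ⟨b1, by rw [hd]; nlinarith, fun heq => ?_⟩
      obtain ⟨τ, b, c1, c2, c3⟩ := b3 (by rw [hd] at heq; rw [hs'] at *; nlinarith)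
      refine ⟨τ + 1, b, chain_one c1 (hdesc u humem) hvd (mem_ch.1 humem).1 (mem_ch.1 humem).2,
        by rw [ht, c2]; push_cast; ring, by rw [hs, c3]; push_cast; ring⟩
  · have hdeg2 : ¬ G.degree v = 2 := by omega
    rw [if_neg hdeg2, zero_add] at ht
    have hI : ∀ i ∈ ch p c v, 1 ≤ (fun i => sz p i - tt G p i) i ∧
        (fun i => sz p i - tt G p i) i ≤ sz p i ∧
        4 * dd p i ≤ bb (sz p i) ((fun i => sz p i - tt G p i) i) := fun i hi =>
      ⟨(hch i hi).1, by have := tt_nonneg (G := G) (p := p) i; simp only; linarith, (hch i hi).2.1⟩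
    obtain ⟨g1, g2⟩ := group_two _ hI hge
    have g3 := group_eq _ hI hge
    have hE : ∑ i ∈ ch p c v, (sz p i - tt G p i) = sz p v - tt G p v - 1 := by
      rw [Finset.sum_sub_distrib]; linarith
    have hS : ∑ i ∈ ch p c v, sz p i = sz p v - 1 := by linarith
    rw [hE, hS] at g2 g3
    rw [hE] at g1
    unfold BC bb
    refine ⟨by linarith, by rw [hd]; nlinarith, fun heq => ?_⟩
    obtain ⟨u, w, huw, hI2, k1, k2, k3, k4⟩ := g3 (by rw [hd] at heq; nlinarith)
    have hum : u ∈ ch p c v := by rw [hI2]; simp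
    have hwm : w ∈ ch p c v := by rw [hI2]; simp
    obtain ⟨τ, b, c1, c2, c3⟩ := (hch u hum).2.2 k4
    have hτ : τ = 0 := by
      have : (τ : ℤ) = 0 := by rw [← c2]; linarith
      exact_mod_cast this
    subst hτ
    rw [hI2, Finset.sum_pair huw] at hs ht
    refine ⟨0, b + 1, chain_two c1 (hdesc u hum) hvd (mem_ch.1 hum).1 (mem_ch.1 hum).2
      (mem_ch.1 hwm).1 (mem_ch.1 hwm).2 huw.symm (ch_desc hwm), ?_, ?_⟩
    · push_cast; linarith
    · push_cast at *; linarith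

theorem Rooted.bc (R : Rooted G c p h) {v : V} (hv : v ≠ c) : BC G c p v :=
  R.branch (desc p v).card v le_rfl hv

end

theorem num_aux1 {y g t : ℤ} (hy : 2 ≤ y) (ht : 0 ≤ t) (hg : 0 ≤ g) :
    7 ≤ 4 * (y - 1) ^ 2 + 2 - 2 * y ^ 2 + 2 * g * (y + 3) + (1 + y + t - g) ^ 2 := by
  rcases le_or_gt g (1 + y) with h | h
  · have a6 : (1 + y - g) ^ 2 ≤ (1 + y + t - g) ^ 2 := by
      apply pow_le_pow_left₀ <;> linarith
    nlinarith
  · have a6 := sq_nonneg (1 + y + t - g)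
    have a7 : (1 + y) * (y + 3) ≤ g * (y + 3) :=
      mul_le_mul_of_nonneg_right (by linarith) (by linarith)
    nlinarith

theorem num_three_aux {s1 s2 s3 e1 e2 e3 m n : ℤ} (hn : n = s1 + s2 + s3 + 1)
    (he : e1 + e2 + e3 = 2 * m + 1) (h1 : 1 ≤ e1) (h2 : 1 ≤ e2) (h3 : 1 ≤ e3)
    (k1 : e1 ≤ s1) (k2 : e2 ≤ s2) (k3 : e3 ≤ s3) (h12 : s2 ≤ s1) (h13 : s3 ≤ s1)
    (hy : 2 ≤ s2 + s3 - s1) :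
    2 * (bb s1 e1 + bb s2 e2 + bb s3 e3) + 7 ≤ 2 * n ^ 2 - 4 * m ^ 2 := by
  unfold bb
  have hm : 4 * m ^ 2 = (e1 + e2 + e3 - 1) ^ 2 := by rw [he]; ring
  rw [hm, hn]
  obtain ⟨y, hyd⟩ : ∃ y, y = s2 + s3 - s1 := ⟨_, rfl⟩
  obtain ⟨P, hP⟩ : ∃ P, P = s2 - e2 := ⟨_, rfl⟩
  obtain ⟨r, hr⟩ : ∃ r, r = s3 - e3 := ⟨_, rfl⟩
  obtain ⟨t1, ht1⟩ : ∃ t1, t1 = s1 - e1 := ⟨_, rfl⟩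
  obtain ⟨A, hA⟩ : ∃ A, A = s2 - 1 := ⟨_, rfl⟩
  obtain ⟨B, hB⟩ : ∃ B, B = s3 - 1 := ⟨_, rfl⟩
  have E1 : e1 = A + B + 2 - y - t1 := by linarith
  have E2 : e2 = A + 1 - P := by linarith
  have E3 : e3 = B + 1 - r := by linarith
  have S1 : s1 = A + B + 2 - y := by linarith
  have S2 : s2 = A + 1 := by linarith
  have S3 : s3 = B + 1 := by linarith
  have p0 : 0 ≤ P := by linarith
  have r0 : 0 ≤ r := by linarith
  have t0 : 0 ≤ t1 := by linarith
  have pA : 0 ≤ A - P := by linarith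
  have rB : 0 ≤ B - r := by linarith
  have yA : 0 ≤ A - (y - 1) := by linarith
  have yB : 0 ≤ B - (y - 1) := by linarith
  have hy2 : 2 ≤ y := by linarith
  rw [E1, E2, E3, S1, S2, S3]
  have key : 7 ≤ 4 * A * B + 2 - 2 * y ^ 2 + 4 * P * (B + 2) + 4 * r * (A + 2) - 4 * P * r +
      (1 + y + t1 - (P + r)) ^ 2 := by
    have a1 : 0 ≤ P * (B - r) := mul_nonneg p0 rB
    have a2 : 0 ≤ r * (A - P) := mul_nonneg r0 pA
    have a3 : 0 ≤ P * (B - (y - 1)) := mul_nonneg p0 yB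
    have a4 : 0 ≤ r * (A - (y - 1)) := mul_nonneg r0 yA
    have a5 : (y - 1) ^ 2 ≤ A * B := by
      rw [sq]; exact mul_le_mul (by linarith) (by linarith) (by linarith) (by linarith)
    have a6 : 4 * (y - 1) ^ 2 + 2 - 2 * y ^ 2 + 2 * (P + r) * (y + 3) ≤
        4 * A * B + 2 - 2 * y ^ 2 + 4 * P * (B + 2) + 4 * r * (A + 2) - 4 * P * r := by linarith
    have a7 := num_aux1 hy2 t0 (by linarith : 0 ≤ P + r)
    linarith
  linarith [key]

theorem num_three {s1 s2 s3 e1 e2 e3 m n : ℤ} (hn : n = s1 + s2 + s3 + 1)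
    (he : e1 + e2 + e3 = 2 * m + 1) (h1 : 1 ≤ e1) (h2 : 1 ≤ e2) (h3 : 1 ≤ e3)
    (k1 : e1 ≤ s1) (k2 : e2 ≤ s2) (k3 : e3 ≤ s3)
    (b1 : 2 * s1 ≤ n - 3) (b2 : 2 * s2 ≤ n - 3) (b3 : 2 * s3 ≤ n - 3) :
    2 * (bb s1 e1 + bb s2 e2 + bb s3 e3) + 7 ≤ 2 * n ^ 2 - 4 * m ^ 2 := by
  rcases le_total s1 s2 with c1 | c1
  · rcases le_total s2 s3 with c2 | c2
    · have := @num_three_aux s3 s1 s2 e3 e1 e2 m n (by linarith) (by linarith) h3 h1 h2 k3 k1 k2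
        (by linarith) (by linarith) (by linarith)
      linarith
    · have := @num_three_aux s2 s1 s3 e2 e1 e3 m n (by linarith) (by linarith) h2 h1 h3 k2 k1 k3
        (by linarith) (by linarith) (by linarith)
      linarith
  · rcases le_total s1 s3 with c2 | c2
    · have := @num_three_aux s3 s1 s2 e3 e1 e2 m n (by linarith) (by linarith) h3 h1 h2 k3 k1 k2
        (by linarith) (by linarith) (by linarith)
      linarith
    · exact @num_three_aux s1 s2 s3 e1 e2 e3 m n (by linarith) (by linarith) h1 h2 h3 k1 k2 k3
        (by linarith) (by linarith) (by linarith)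

theorem num_two {s S d d' D D' a b K : ℤ} (hd : d + d' = 2 * (a + b)) (hab : b ≤ a) (hab' : a ≤ b + 1)
    (hK : K = 2 * s * (s + 1) + 2 * S * (S + 1))
    (h1 : 4 * D ≤ 2 * s * (s + 1) - d ^ 2) (h2 : 4 * D' ≤ 2 * S * (S + 1) - d' ^ 2)
    (h3 : K - 4 * a ^ 2 - 4 * b ^ 2 ≤ 4 * (D + D')) :
    4 * D = 2 * s * (s + 1) - d ^ 2 ∧ 4 * D' = 2 * S * (S + 1) - d' ^ 2 ∧
      ((d = 2 * a ∧ d' = 2 * b) ∨ (d = 2 * b ∧ d' = 2 * a)) := by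
  obtain ⟨r, hr⟩ : ∃ r, d = a + b + r := ⟨d - a - b, by ring⟩
  have hr' : d' = a + b - r := by linarith
  obtain ⟨δ, hδ⟩ : ∃ δ, a = b + δ := ⟨a - b, by ring⟩
  have hδ' : δ = 0 ∨ δ = 1 := by omega
  subst hK
  have hm : 2 * r ^ 2 + (2 * s * (s + 1) - d ^ 2 - 4 * D) + (2 * S * (S + 1) - d' ^ 2 - 4 * D') ≤
      2 * δ ^ 2 := by
    subst hr hr' hδ
    linarith
  have hrr : r ^ 2 ≤ 1 := by rcases hδ' with h | h <;> rw [h] at hm <;> nlinarith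
  have hr1 : r = 0 ∨ r = 1 ∨ r = -1 := by
    have : r ≤ 1 := by nlinarith
    have : -1 ≤ r := by nlinarith
    omega
  have hse : ∃ z, s * (s + 1) = 2 * z := by
    obtain ⟨z, hz⟩ := Int.even_mul_succ_self s
    exact ⟨z, by linarith⟩
  obtain ⟨z, hz⟩ := hse
  have hodd : ∀ k, d = 2 * k + 1 → 2 * δ ^ 2 ≤ 2 → False := by
    intro k hk hδ2
    have e1 : 2 * s * (s + 1) - d ^ 2 - 4 * D = 4 * (z - k ^ 2 - k - D) - 1 := by
      rw [hk]; nlinarith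
    have e2 : 0 ≤ 2 * s * (s + 1) - d ^ 2 - 4 * D := by linarith
    have e3 : 2 * s * (s + 1) - d ^ 2 - 4 * D ≤ 2 := by nlinarith
    omega
  rcases hδ' with h | h
  · rw [h] at hm hδ
    have hr0 : r = 0 := by nlinarith
    subst hr0
    refine ⟨by nlinarith, by nlinarith, Or.inl ⟨by linarith, by linarith⟩⟩
  · rw [h] at hm hδ
    rcases hr1 with h0 | h0 | h0
    · exact (hodd b (by rw [hr, h0, hδ]; ring) (by rw [h]; norm_num)).elim
    · rw [h0] at hm
      refine ⟨by nlinarith, by nlinarith, Or.inl ⟨by linarith, by linarith⟩⟩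
    · rw [h0] at hm
      refine ⟨by nlinarith, by nlinarith, Or.inr ⟨by linarith, by linarith⟩⟩

/-- Shape of an extremal tree. -/
def TwoChains {V : Type*} [Fintype V] (c : V) (p : V → V) (a b : ℕ) : Prop :=
  ∃ u τ₁ b₁ τ₂ b₂, u ≠ c ∧ p u = c ∧ Chain p c (desc p u : Set V) u τ₁ b₁ ∧
    Chain p c ((desc p u : Set V)ᶜ) c τ₂ b₂ ∧
    τ₁ + 2 * b₁ + 1 + (τ₂ + 2 * b₂ + 1) = Fintype.card V ∧
    ((b₁ = a ∧ b₂ = b) ∨ (b₁ = b ∧ b₂ = a))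

theorem num_K {n s S : ℤ} (hn : s + S = n - 1) (h1 : s ≤ S + 1) (h2 : S ≤ s + 1) :
    n ^ 2 - n % 2 = 2 * s * (s + 1) + 2 * S * (S + 1) := by
  rcases (by omega : S = s ∨ S = s + 1 ∨ s = S + 1) with h | h | h
  · have : n % 2 = 1 := by omega
    rw [this]
    have : n = 2 * s + 1 := by omega
    rw [this, h]; ring
  · have : n % 2 = 0 := by omega
    rw [this]
    have : n = 2 * s + 2 := by omega
    rw [this, h]; ring
  · have : n % 2 = 0 := by omega
    rw [this]
    have : n = 2 * S + 2 := by omega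
    rw [this, h]; ring

section
variable {V : Type*} [Fintype V] {G : SimpleGraph V} {c : V} {p : V → V} {h : V → ℕ}

theorem Rooted.hI (R : Rooted G c p h) {I : Finset V} (hI : I ⊆ ch p c c) :
    ∀ i ∈ I, 1 ≤ (fun i => sz p i - tt G p i) i ∧
        (fun i => sz p i - tt G p i) i ≤ sz p i ∧
        4 * dd p i ≤ bb (sz p i) ((fun i => sz p i - tt G p i) i) := fun i hi => by
  have hb := R.bc (mem_ch.1 (hI hi)).1
  exact ⟨hb.1, by have := tt_nonneg (G := G) (p := p) i; simp only; linarith, hb.2.1⟩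

theorem Rooted.case_one (R : Rooted G c p h) {a b : ℕ} {n : ℤ} (hn : n = Fintype.card V)
    (hn4 : 4 ≤ n) (hab : b ≤ a) (hab' : a ≤ b + 1)
    (ht : n - tt G p c = 2 * (a + b) + 2)
    (hK : n ^ 2 - n % 2 - 4 * (a : ℤ) ^ 2 - 4 * (b : ℤ) ^ 2 ≤ 4 * ∑ u ∈ ch p c c, dd p u)
    {u : V} (hu : u ∈ ch p c c)
    (h1 : sz p u ≤ ∑ w ∈ (ch p c c).erase u, sz p w + 1)
    (h2 : ∑ w ∈ (ch p c c).erase u, sz p w ≤ sz p u + 1) : TwoChains c p a b := by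
  have huc := mem_ch.1 hu
  have hs := R.sz_eq c
  rw [R.sz_c, ← hn, ← Finset.add_sum_erase _ _ hu] at hs
  have hT := R.tt_eq c
  rw [R.degree_c, ← Finset.add_sum_erase _ _ hu] at hT
  rw [← Finset.add_sum_erase _ _ hu] at hK
  have hcard : (ch p c c).card = ((ch p c c).erase u).card + 1 := by
    rw [Finset.card_erase_of_mem hu]
    have := Finset.card_pos.2 ⟨u, hu⟩
    omega
  obtain ⟨J, hJ⟩ : ∃ J, J = (ch p c c).erase u := ⟨_, rfl⟩
  have hJs : J ⊆ ch p c c := hJ ▸ Finset.erase_subset _ _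
  have huJ : u ∉ J := by rw [hJ]; simp
  rw [← hJ] at h1 h2 hs hT hK hcard
  have hKn := num_K (n := n) (by linarith) h1 h2
  have hbu := R.bc huc.1
  have hub := hbu.2.1
  unfold bb at hub
  have hcM : c ∈ ((desc p u : Set V)ᶜ) := by
    simp only [Set.mem_compl_iff, Finset.mem_coe]
    exact R.ch_not_desc hu
  have hJM : ∀ w ∈ J, (desc p w : Set V) ⊆ ((desc p u : Set V)ᶜ) := by
    intro w hw z hz hz'
    have := R.ch_disjoint hu (hJs hw) hz' hz
    exact huJ (this ▸ hw)
  rcases (by omega : J.card = 0 ∨ J.card = 1 ∨ 2 ≤ J.card) with h0 | h0 | h0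
  · rw [Finset.card_eq_zero] at h0
    rw [h0] at h1 hs
    simp only [Finset.sum_empty] at h1 hs
    linarith
  · clear hJ
    obtain ⟨w, rfl⟩ := Finset.card_eq_one.1 h0
    have hw := mem_ch.1 (hJs (Finset.mem_singleton_self w))
    rw [hcard, h0] at hT
    simp only [Finset.sum_singleton] at *
    norm_num at hT
    have hbw := R.bc hw.1
    have hwb := hbw.2.1
    unfold bb at hwb
    obtain ⟨q1, q2, q3⟩ := num_two (a := a) (b := b) (d := sz p u - tt G p u - 1)
      (d' := sz p w - tt G p w - 1) (by linarith) (by exact_mod_cast hab) (by exact_mod_cast hab')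
      hKn hub hwb hK
    obtain ⟨τ₁, b₁, c1, c2, c3⟩ := hbu.2.2 q1
    obtain ⟨τ₂, b₂, d1, d2, d3⟩ := hbw.2.2 q2
    refine ⟨u, τ₁, b₁, τ₂ + 1, b₂, huc.1, huc.2, c1,
      chain_one d1 (hJM w (by simp)) hcM hw.1 hw.2, ?_, ?_⟩
    · zify; linarith
    · rcases q3 with ⟨q3, q4⟩ | ⟨q3, q4⟩
      · left; constructor <;> zify <;> linarith
      · right; constructor <;> zify <;> linarith
  · rw [if_neg (by omega), zero_add] at hT
    have hII := R.hI hJs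
    obtain ⟨g1, g2⟩ := group_two _ hII h0
    have g3 := group_eq _ hII h0
    have hE : ∑ i ∈ J, (sz p i - tt G p i) = ∑ i ∈ J, sz p i - ∑ i ∈ J, tt G p i :=
      Finset.sum_sub_distrib _ _
    rw [hE] at g1 g2 g3
    obtain ⟨q1, q2, q3⟩ := num_two (a := a) (b := b) (d := sz p u - tt G p u - 1)
      (d' := ∑ i ∈ J, sz p i - ∑ i ∈ J, tt G p i)
      (by linarith) (by exact_mod_cast hab) (by exact_mod_cast hab')
      hKn hub g2 hK
    obtain ⟨τ₁, b₁, c1, c2, c3⟩ := hbu.2.2 q1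
    obtain ⟨x, w, hxw, hI2, k1, k2, k3, k4⟩ := g3 q2
    have hxJ : x ∈ J := by rw [hI2]; simp
    have hwJ : w ∈ J := by rw [hI2]; simp
    have hx := mem_ch.1 (hJs hxJ)
    have hw := mem_ch.1 (hJs hwJ)
    obtain ⟨τ, b₂, d1, d2, d3⟩ := (R.bc hx.1).2.2 k4
    have hτ : τ = 0 := by
      have : (τ : ℤ) = 0 := by rw [← d2]; linarith
      exact_mod_cast this
    subst hτ
    have s1 : ∑ i ∈ J, sz p i = sz p x + sz p w := by rw [hI2, Finset.sum_pair hxw]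
    have s2 : ∑ i ∈ J, tt G p i = tt G p x + tt G p w := by rw [hI2, Finset.sum_pair hxw]
    refine ⟨u, τ₁, b₁, 0, b₂ + 1, huc.1, huc.2, c1,
      chain_two d1 (hJM x hxJ) hcM hx.1 hx.2 hw.1 hw.2 hxw.symm
        (hJM w hwJ (desc_self w)), ?_, ?_⟩
    · zify; push_cast at *; linarith
    · push_cast at *
      rcases q3 with ⟨q3, q4⟩ | ⟨q3, q4⟩
      · left; constructor <;> zify <;> linarith
      · right; constructor <;> zify <;> linarith

theorem Rooted.root (R : Rooted G c p h) (hc : ∀ v ≠ c, 2 * sz p v ≤ Fintype.card V)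
    {a b : ℕ} {n : ℤ} (hn : n = Fintype.card V)
    (hn4 : 4 ≤ n) (hab : b ≤ a) (hab' : a ≤ b + 1) (hpos : 1 ≤ a + b)
    (ht : n - tt G p c = 2 * (a + b) + 2)
    (hK : n ^ 2 - n % 2 - 4 * (a : ℤ) ^ 2 - 4 * (b : ℤ) ^ 2 ≤ 4 * ∑ u ∈ ch p c c, dd p u) :
    TwoChains c p a b := by
  have hs := R.sz_eq c
  rw [R.sz_c, ← hn] at hs
  have hT := R.tt_eq c
  rw [R.degree_c] at hT
  obtain ⟨I, hIm, hmax⟩ := Finset.exists_max_image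
    ((ch p c c).powerset.filter fun I => 2 * ∑ i ∈ I, sz p i ≤ n - 1) (fun I => ∑ i ∈ I, sz p i)
    ⟨∅, by simp; linarith⟩
  simp only [Finset.mem_filter, Finset.mem_powerset] at hIm hmax
  obtain ⟨hIs, hI2⟩ := hIm
  have hmax' : ∀ J, J ⊆ ch p c c → 2 * ∑ i ∈ J, sz p i ≤ n - 1 →
      ∑ i ∈ J, sz p i ≤ ∑ i ∈ I, sz p i := fun J h1 h2 => hmax J ⟨h1, h2⟩
  have hpart : ∀ F : V → ℤ, ∑ i ∈ ch p c c \ I, F i + ∑ i ∈ I, F i = ∑ i ∈ ch p c c, F i :=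
    fun F => Finset.sum_sdiff hIs
  have hcard := Finset.card_sdiff_add_card_eq_card hIs
  have hJs : ch p c c \ I ⊆ ch p c c := Finset.sdiff_subset
  have hab2 : (a : ℤ) - b = 0 ∨ (a : ℤ) - b = 1 := by omega
  have hposZ : (1 : ℤ) ≤ a + b := by exact_mod_cast hpos
  have hSI := hpart (sz p)
  have hTI := hpart (tt G p)
  have hDI := hpart (dd p)
  rcases le_or_gt (n - 2) (2 * ∑ i ∈ I, sz p i) with hi | hi
  · have hne1 : I.Nonempty := by
      rw [Finset.nonempty_iff_ne_empty]
      rintro rfl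
      simp at hi
      linarith
    have hne2 : (ch p c c \ I).Nonempty := by
      rw [Finset.nonempty_iff_ne_empty]
      intro h0
      rw [h0] at hSI
      simp at hSI
      linarith
    rcases Nat.lt_or_ge I.card 2 with hc1 | hc1
    · have h1 : I.card = 1 := by have := Finset.card_pos.2 hne1; omega
      obtain ⟨u, rfl⟩ := Finset.card_eq_one.1 h1
      rw [← Finset.erase_eq] at *
      simp only [Finset.sum_singleton] at *
      exact R.case_one hn hn4 hab hab' ht hK (u := u) (hIs (by simp)) (by linarith) (by linarith)
    rcases Nat.lt_or_ge (ch p c c \ I).card 2 with hc2 | hc2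
    · have h1 : (ch p c c \ I).card = 1 := by have := Finset.card_pos.2 hne2; omega
      obtain ⟨u, hu⟩ := Finset.card_eq_one.1 h1
      have hIe : I = (ch p c c).erase u := by
        rw [Finset.erase_eq, ← hu, Finset.sdiff_sdiff_eq_self hIs]
      rw [hu] at hSI
      simp only [Finset.sum_singleton] at hSI
      exact R.case_one hn hn4 hab hab' ht hK (u := u) (hJs (by rw [hu]; simp))
        (by rw [← hIe]; linarith) (by rw [← hIe]; linarith)
    exfalso
    obtain ⟨-, g2⟩ := group_two _ (R.hI hIs) hc1
    obtain ⟨-, g4⟩ := group_two _ (R.hI hJs) hc2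
    rw [if_neg (by omega), zero_add] at hT
    rw [Finset.sum_sub_distrib] at g2 g4
    have hKn := num_K (n := n) (s := ∑ i ∈ I, sz p i) (S := ∑ i ∈ ch p c c \ I, sz p i)
      (by linarith) (by linarith) (by linarith)
    have hsum : (∑ i ∈ I, sz p i - ∑ i ∈ I, tt G p i) +
      (∑ i ∈ ch p c c \ I, sz p i - ∑ i ∈ ch p c c \ I, tt G p i) = 2 * (a + b) + 1 := by linarith
    generalize (∑ i ∈ I, sz p i - ∑ i ∈ I, tt G p i) = E1 at *
    generalize (∑ i ∈ ch p c c \ I, sz p i - ∑ i ∈ ch p c c \ I, tt G p i) = E2 at *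
    have hfin : E1 ^ 2 + E2 ^ 2 ≤ 4 * (a : ℤ) ^ 2 + 4 * (b : ℤ) ^ 2 := by linarith
    have h5 : (2 * ((a : ℤ) + b) + 1) ^ 2 ≤ 2 * (E1 ^ 2 + E2 ^ 2) := by
      rw [← hsum]; nlinarith [sq_nonneg (E1 - E2)]
    rcases hab2 with h6 | h6
    · have h7 : (a : ℤ) = b := by linarith
      rw [h7] at h5 hfin hposZ
      nlinarith
    · have h7 : (a : ℤ) = b + 1 := by linarith
      rw [h7] at h5 hfin hposZ
      nlinarith
  · exfalso
    have hne2 : (ch p c c \ I).Nonempty := by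
      rw [Finset.nonempty_iff_ne_empty]
      intro h0
      rw [h0] at hSI
      simp at hSI
      linarith
    obtain ⟨i, hiJ⟩ := hne2
    have hi' := Finset.mem_sdiff.1 hiJ
    have hip := sz_pos (p := p) i
    have hin : i ∉ I := hi'.2
    have hins : n - 1 < 2 * (sz p i + ∑ j ∈ I, sz p j) := by
      by_contra hcon
      have := hmax' (insert i I) (Finset.insert_subset hi'.1 hIs)
        (by rw [Finset.sum_insert hin]; linarith)
      rw [Finset.sum_insert hin] at this
      linarith
    have hrest : ∀ F : V → ℤ, F i + ∑ j ∈ (ch p c c \ I).erase i, F j =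
        ∑ j ∈ (ch p c c \ I), F j := fun F => Finset.add_sum_erase _ _ hiJ
    have hr1 := hrest (sz p)
    have hr2 := hrest (tt G p)
    have hr3 := hrest (dd p)
    have hRs : (ch p c c \ I).erase i ⊆ ch p c c := (Finset.erase_subset _ _).trans hJs
    have hR : ∑ j ∈ (ch p c c \ I).erase i, sz p j ≤ ∑ j ∈ I, sz p j :=
      hmax' _ hRs (by linarith)
    have hisz : sz p i ≤ ∑ j ∈ I, sz p j := by
      by_cases hle : 2 * sz p i ≤ n - 1
      · have := hmax' {i} (by simpa using hi'.1) (by simpa using hle)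
        simpa using this
      · have h3 := Finset.add_sum_erase _ (sz p) hi'.1
        have h4 := hmax' ((ch p c c).erase i) (Finset.erase_subset _ _) (by linarith)
        have h5 := hc i (mem_ch.1 hi'.1).1
        rw [← hn] at h5
        omega
    have hneI : I.Nonempty := by
      rw [Finset.nonempty_iff_ne_empty]
      rintro rfl
      simp at hisz
      linarith
    have hneR : ((ch p c c \ I).erase i).Nonempty := by
      rw [Finset.nonempty_iff_ne_empty]
      intro h0
      rw [h0] at hr1
      simp at hr1
      linarith
    have hc1 := Finset.card_pos.2 hneI
    have hc2 := Finset.card_pos.2 hneR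
    rw [Finset.card_erase_of_mem hiJ] at hc2
    rw [if_neg (by omega), zero_add] at hT
    obtain ⟨g1, g2, g3⟩ := group_one _ (R.hI hIs) hneI
    obtain ⟨g4, g5, g6⟩ := group_one _ (R.hI hRs) hneR
    obtain ⟨g7, g8, g9⟩ := R.hI (I := ch p c c) (fun _ h => h) i hi'.1
    simp only at g7 g8 g9
    rw [Finset.sum_sub_distrib] at g1 g2 g3 g4 g5 g6
    have hfin := num_three (n := n) (m := a + b) (by linarith) (by linarith) g1 g4 g7 g2 g5 g8
      (by omega) (by omega) (by omega)
    have hmod : n % 2 ≤ 1 := by omega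
    rcases hab2 with h6 | h6
    · have h7 : (a : ℤ) = b := by linarith
      rw [h7] at hfin hK
      linarith
    · have h7 : (a : ℤ) = b + 1 := by linarith
      rw [h7] at hfin hK
      linarith

end

theorem iso_of_hom {V W : Type*} [Fintype V] [Fintype W] {G : SimpleGraph V} {H : SimpleGraph W}
    (f : V → W) (hf : Function.Bijective f) (hadj : ∀ u v, G.Adj u v → H.Adj (f u) (f v))
    (hcard : G.edgeFinset.card = H.edgeFinset.card) : Nonempty (G ≃g H) := by
  have hinj : Function.Injective (Sym2.map f) := Sym2.map.injective hf.1
  have hsub : G.edgeFinset.image (Sym2.map f) ⊆ H.edgeFinset := by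
    intro e he
    rw [Finset.mem_image] at he
    obtain ⟨e', he', rfl⟩ := he
    induction e' using Sym2.ind with
    | _ u v =>
      rw [mem_edgeFinset, mem_edgeSet] at he'
      rw [Sym2.map_mk, mem_edgeFinset, mem_edgeSet]
      exact hadj u v he'
  have heq := Finset.eq_of_subset_of_card_le hsub (by
    rw [Finset.card_image_of_injective _ hinj, hcard])
  refine ⟨⟨Equiv.ofBijective f hf, ?_⟩⟩
  intro u v
  simp only [Equiv.ofBijective_apply]
  refine ⟨fun h1 => ?_, hadj u v⟩
  have h2 : s(f u, f v) ∈ H.edgeFinset := by rwa [mem_edgeFinset, mem_edgeSet]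
  rw [← heq, Finset.mem_image] at h2
  obtain ⟨e, he, h3⟩ := h2
  have h4 : e = s(u, v) := hinj (by rw [h3, Sym2.map_mk])
  rw [h4, mem_edgeFinset, mem_edgeSet] at he
  exact he

/-- parent function of `catC` -/
def cp (n a b v : ℕ) : ℕ :=
  if v < n - a - b then v - 1 else if v < n - b then v - (n - a - b) + 1 else v - a - b - 1

theorem cp_le {n a b v : ℕ} (hab : 2 * (a + b) + 2 ≤ n) (hv : v < n) : cp n a b v < n := by
  unfold cp; split_ifs <;> omega

theorem catC_adj {n a b : ℕ} {u v : Fin n} :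
    (catC n a b).Adj u v ↔ u ≠ v ∧ (cp n a b u = v ∨ cp n a b v = u) := by
  unfold catC parentGraph
  rw [SimpleGraph.fromRel_adj]
  rfl

theorem catC_rooted {n a b : ℕ} (hab : 2 * (a + b) + 2 ≤ n) :
    Rooted (catC n a b) (⟨0, by omega⟩ : Fin n) (fun v => ⟨cp n a b v, cp_le hab v.2⟩)
      (fun v => if (v : ℕ) < n - a - b then v else cp n a b v + 1) := by
  refine ⟨?_, ?_, ?_⟩
  · apply Fin.ext
    simp only [cp]
    split_ifs <;> omega
  · rintro ⟨v, hv⟩ hne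
    have hne' : v ≠ 0 := fun h0 => hne (Fin.ext h0)
    simp only [cp]
    split_ifs <;> omega
  · rintro ⟨u, hu⟩ ⟨v, hv⟩
    rw [catC_adj]
    simp only [ne_eq, Fin.mk.injEq]
    unfold cp
    split_ifs <;> omega

section
variable {V : Type*} [Fintype V] {G : SimpleGraph V} {c : V} {p : V → V} {h : V → ℕ}

theorem Rooted.chain_facts (R : Rooted G c p h) {M : Set V} {v : V} {τ b : ℕ}
    (hC : Chain p c M v τ b) : ∃ x y : ℕ → V, x 0 = v ∧
      (∀ i < τ + b, G.Adj (x (i + 1)) (x i)) ∧ (∀ i < b, G.Adj (y i) (x (τ + i))) ∧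
      (∀ i ≤ τ + b, ∀ j ≤ τ + b, x i = x j → i = j) ∧ (∀ i < b, ∀ j < b, y i = y j → i = j) ∧
      (∀ i ≤ τ + b, ∀ j < b, x i ≠ y j) ∧ (∀ i ≤ τ + b, x i ∈ M) ∧ (∀ i < b, y i ∈ M) := by
  obtain ⟨x, y, h0, h1, h2, h3, h4⟩ := hC
  have hx : ∀ i ≤ τ + b, h (x i) = h v + i := by
    intro i
    induction i with
    | zero => intro _; rw [h0]; rfl
    | succ i ih =>
      intro hi
      have k1 := h1 i (by omega)
      have k2 := R.hp _ k1.1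
      rw [k1.2, ih (by omega)] at k2
      omega
  have hy : ∀ i < b, h (y i) = h v + τ + i + 1 := by
    intro i hi
    have k1 := h2 i hi
    have k2 := R.hp _ k1.1
    rw [k1.2.1, hx _ (by omega)] at k2
    omega
  refine ⟨x, y, h0, ?_, ?_, ?_, ?_, ?_, h3, h4⟩
  · intro i hi
    have k1 := h1 i hi
    rw [← k1.2]; exact R.adj_parent k1.1
  · intro i hi
    have k1 := h2 i hi
    rw [← k1.2.1]; exact R.adj_parent k1.1
  · intro i hi j hj hij
    have k1 := hx i hi
    have k2 := hx j hj
    rw [hij] at k1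
    omega
  · intro i hi j hj hij
    have k1 := hy i hi
    have k2 := hy j hj
    rw [hij] at k1
    omega
  · intro i hi j hj hij
    have k1 := hx i hi
    have k2 := hy j hj
    rw [hij] at k1
    have k3 : i = τ + j + 1 := by omega
    rw [k3] at hij
    exact (h2 j hj).2.2 hij.symm

end

theorem iso_of_chains {n : ℕ} {T : SimpleGraph (Fin n)} {c : Fin n} {p : Fin n → Fin n}
    {h : Fin n → ℕ} (R : Rooted T c p h) {M M' : Set (Fin n)} (hM : Disjoint M M')
    {v v' : Fin n} {τ a τ' b : ℕ} (hA : Chain p c M v τ a) (hB : Chain p c M' v' τ' b)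
    (hadj : T.Adj v v') (hn : n = τ + 2 * a + 1 + (τ' + 2 * b + 1)) :
    Nonempty (T ≃g catC n a b) := by
  obtain ⟨x, y, x0, x1, y1, xx, yy, xy, xM, yM⟩ := R.chain_facts hA
  obtain ⟨x', y', x0', x1', y1', xx', yy', xy', xM', yM'⟩ := R.chain_facts hB
  have hdis : ∀ {s t}, s ∈ M → t ∈ M' → s ≠ t := by
    intro s t hs ht hst
    exact Set.disjoint_left.1 hM hs (hst ▸ ht)
  have hRC := catC_rooted (n := n) (a := a) (b := b) (by omega)
  have hcard : (catC n a b).edgeFinset.card = T.edgeFinset.card := by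
    have k1 := hRC.card_edges
    have k2 := R.card_edges
    omega
  let F : ℕ → Fin n := fun k => if k < τ + a + 1 then x (τ + a - k)
    else if k < n - a - b then x' (k - (τ + a + 1))
    else if k < n - b then y (a - 1 - (k - (n - a - b))) else y' (k - (n - b))
  have F1 : ∀ k, k < τ + a + 1 → F k = x (τ + a - k) := fun k hk => if_pos hk
  have F2 : ∀ k, τ + a + 1 ≤ k → k < n - a - b → F k = x' (k - (τ + a + 1)) := fun k h1 h2 => by
    simp only [F]; rw [if_neg (by omega), if_pos h2]
  have F3 : ∀ k, n - a - b ≤ k → k < n - b → F k = y (a - 1 - (k - (n - a - b))) :=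
    fun k h1 h2 => by
      simp only [F]; rw [if_neg (by omega), if_neg (by omega), if_pos h2]
  have F4 : ∀ k, n - b ≤ k → F k = y' (k - (n - b)) := fun k h1 => by
    simp only [F]; rw [if_neg (by omega), if_neg (by omega), if_neg (by omega)]
  have hinj : ∀ k l, k < n → l < n → k < l → F k ≠ F l := by
    intro k l hk hl hkl
    rcases (by omega : k < τ + a + 1 ∨ (τ + a + 1 ≤ k ∧ k < n - a - b) ∨
      (n - a - b ≤ k ∧ k < n - b) ∨ n - b ≤ k) with hk1 | ⟨hk1, hk2⟩ | ⟨hk1, hk2⟩ | hk1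
    · rw [F1 k hk1]
      rcases (by omega : l < τ + a + 1 ∨ (τ + a + 1 ≤ l ∧ l < n - a - b) ∨
        (n - a - b ≤ l ∧ l < n - b) ∨ n - b ≤ l) with hl1 | ⟨hl1, hl2⟩ | ⟨hl1, hl2⟩ | hl1
      · rw [F1 l hl1]
        intro he; have := xx _ (by omega) _ (by omega) he; omega
      · rw [F2 l hl1 hl2]; exact hdis (xM _ (by omega)) (xM' _ (by omega))
      · rw [F3 l hl1 hl2]; exact xy _ (by omega) _ (by omega)
      · rw [F4 l hl1]; exact hdis (xM _ (by omega)) (yM' _ (by omega))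
    · rw [F2 k hk1 hk2]
      rcases (by omega : (τ + a + 1 ≤ l ∧ l < n - a - b) ∨
        (n - a - b ≤ l ∧ l < n - b) ∨ n - b ≤ l) with ⟨hl1, hl2⟩ | ⟨hl1, hl2⟩ | hl1
      · rw [F2 l hl1 hl2]
        intro he; have := xx' _ (by omega) _ (by omega) he; omega
      · rw [F3 l hl1 hl2]; exact (hdis (yM _ (by omega)) (xM' _ (by omega))).symm
      · rw [F4 l hl1]; exact xy' _ (by omega) _ (by omega)
    · rw [F3 k hk1 hk2]
      rcases (by omega : (n - a - b ≤ l ∧ l < n - b) ∨ n - b ≤ l) with ⟨hl1, hl2⟩ | hl1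
      · rw [F3 l hl1 hl2]
        intro he; have := yy _ (by omega) _ (by omega) he; omega
      · rw [F4 l hl1]; exact hdis (yM _ (by omega)) (yM' _ (by omega))
    · rw [F4 k hk1, F4 l (by omega)]
      intro he; have := yy' _ (by omega) _ (by omega) he; omega
  have hpar : ∀ k, k < n → k ≠ 0 → T.Adj (F k) (F (cp n a b k)) := by
    intro k hk hk0
    rcases (by omega : k < τ + a + 1 ∨ k = τ + a + 1 ∨ (τ + a + 1 < k ∧ k < n - a - b) ∨
      (n - a - b ≤ k ∧ k < n - b) ∨ n - b ≤ k) with hk1 | hk1 | ⟨hk1, hk2⟩ | ⟨hk1, hk2⟩ | hk1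
    · have e : cp n a b k = k - 1 := by unfold cp; rw [if_pos (by omega)]
      rw [e, F1 k hk1, F1 (k - 1) (by omega)]
      have := x1 (τ + a - k) (by omega)
      rw [show τ + a - (k - 1) = τ + a - k + 1 by omega]
      exact this.symm
    · have e : cp n a b k = k - 1 := by unfold cp; rw [if_pos (by omega)]
      rw [e, F2 k (by omega) (by omega), F1 (k - 1) (by omega),
        show k - (τ + a + 1) = 0 by omega, show τ + a - (k - 1) = 0 by omega, x0, x0']
      exact hadj.symm
    · have e : cp n a b k = k - 1 := by unfold cp; rw [if_pos (by omega)]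
      rw [e, F2 k (by omega) hk2, F2 (k - 1) (by omega) (by omega)]
      have := x1' (k - 1 - (τ + a + 1)) (by omega)
      rwa [show k - 1 - (τ + a + 1) + 1 = k - (τ + a + 1) by omega] at this
    · have e : cp n a b k = k - (n - a - b) + 1 := by
        unfold cp; rw [if_neg (by omega), if_pos (by omega)]
      rw [e, F3 k hk1 hk2, F1 _ (by omega)]
      have := y1 (a - 1 - (k - (n - a - b))) (by omega)
      rwa [show τ + (a - 1 - (k - (n - a - b))) = τ + a - (k - (n - a - b) + 1) by omega] at this
    · have e : cp n a b k = k - a - b - 1 := by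
        unfold cp; rw [if_neg (by omega), if_neg (by omega)]
      rw [e, F4 k hk1, F2 _ (by omega) (by omega)]
      have := y1' (k - (n - b)) (by omega)
      rwa [show τ' + (k - (n - b)) = k - a - b - 1 - (τ + a + 1) by omega] at this
  have hbij : Function.Bijective (fun v : Fin n => F v) := by
    rw [← Finite.injective_iff_bijective]
    intro u w huw
    by_contra hne
    have hne' : (u : ℕ) ≠ w := fun e => hne (Fin.ext e)
    rcases lt_or_gt_of_ne hne' with hlt | hlt
    · exact hinj u w u.2 w.2 hlt huw
    · exact hinj w u w.2 u.2 hlt huw.symm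
  obtain ⟨φ⟩ := iso_of_hom (fun v : Fin n => F v) hbij (G := catC n a b) (H := T) (by
    intro u w huw
    rw [hRC.adj] at huw
    rcases huw with ⟨h1, h2⟩ | ⟨h1, h2⟩
    · have := hpar u u.2 (fun e => h1 (Fin.ext e))
      rw [← h2]; exact this
    · have := hpar w w.2 (fun e => h1 (Fin.ext e))
      rw [← h2]; exact this.symm) hcard
  exact ⟨φ.symm⟩

theorem Rooted.iso {n : ℕ} {T : SimpleGraph (Fin n)} {c : Fin n} {p : Fin n → Fin n}
    {h : Fin n → ℕ} (R : Rooted T c p h) {a b : ℕ} (hTC : TwoChains c p a b) :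
    Nonempty (T ≃g catC n a b) := by
  obtain ⟨u, τ₁, b₁, τ₂, b₂, hu, huc, C1, C2, hn, hab⟩ := hTC
  rw [Fintype.card_fin] at hn
  have hadj : T.Adj u c := by
    have := R.adj_parent hu
    rwa [huc] at this
  rcases hab with ⟨rfl, rfl⟩ | ⟨rfl, rfl⟩
  · exact iso_of_chains R disjoint_compl_right C1 C2 hadj (by omega)
  · exact iso_of_chains R disjoint_compl_left C2 C1 hadj.symm (by omega)

section
variable {V : Type*} [Fintype V] {G : SimpleGraph V} {c : V} {p : V → V} {h : V → ℕ}

theorem Rooted.desc_root (R : Rooted G c p h) : desc p c = Finset.univ := by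
  ext w; simp [R.desc_c]

theorem Rooted.dd_h (R : Rooted G c p h) : ∀ (k : ℕ) (v : V), sz p v ≤ k →
    ∑ w ∈ desc p v, ((h w : ℤ) - h v + 1) = dd p v := by
  intro k
  induction k with
  | zero => intro v hv; have := sz_pos (p := p) v; push_cast at hv; linarith
  | succ k ih =>
    intro v hk
    rw [R.sum_desc, R.dd_eq, R.sz_eq]
    have : ∀ u ∈ ch p c v, ∑ w ∈ desc p u, ((h w : ℤ) - h v + 1) = dd p u + sz p u := by
      intro u hu
      have h1 := R.ch_sz_lt hu
      rw [← ih u (by push_cast at hk; linarith)]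
      unfold sz
      rw [Finset.card_eq_sum_ones]
      push_cast
      rw [← Finset.sum_add_distrib]
      apply Finset.sum_congr rfl
      intro w _
      rw [R.h_ch hu]; push_cast; ring
    rw [Finset.sum_congr rfl this, Finset.sum_add_distrib]
    ring

theorem Rooted.sum_h (R : Rooted G c p h) (h0 : h c = 0) :
    ∑ u ∈ ch p c c, dd p u = ∑ w, (h w : ℤ) := by
  have h1 := R.dd_h (desc p c).card c le_rfl
  have h2 := R.dd_eq c
  rw [R.desc_root, h0] at h1
  rw [R.sz_c] at h2
  simp only [Nat.cast_zero, sub_zero, Finset.sum_add_distrib, Finset.sum_const, Finset.card_univ,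
    nsmul_eq_mul, mul_one] at h1
  linarith

theorem Rooted.mostar_centroid (R : Rooted G c p h)
    (hc : ∀ v ≠ c, 2 * sz p v ≤ Fintype.card V) :
    (mostar G : ℤ) = (Fintype.card V : ℤ) * (Fintype.card V - 1) -
      2 * ∑ u ∈ ch p c c, dd p u := by
  rw [R.mostar_eq]
  have h1 : ∀ v ∈ Finset.univ.erase c, |(Fintype.card V : ℤ) - 2 * sz p v| =
      Fintype.card V - 2 * sz p v := by
    intro v hv
    have := hc v (Finset.ne_of_mem_erase hv)
    exact abs_of_nonneg (by linarith)
  rw [Finset.sum_congr rfl h1]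
  have h2 := Finset.add_sum_erase Finset.univ
    (fun v => (Fintype.card V : ℤ) - 2 * sz p v) (Finset.mem_univ c)
  have h3 := R.dd_eq c
  have h4 : dd p c = ∑ v, sz p v := by unfold dd; rw [R.desc_root]
  rw [R.sz_c] at h3
  simp only [R.sz_c, Finset.sum_sub_distrib, Finset.sum_const, Finset.card_univ, nsmul_eq_mul,
    ← Finset.mul_sum] at h2
  rw [← h4] at h2
  simp only [Finset.sum_sub_distrib, ← Finset.mul_sum, Finset.sum_const, nsmul_eq_mul]
  linarith

theorem Rooted.sz_le_of_closed {S : Finset V} (hS : ∀ w, w ∉ S → p w ∉ S) {v : V} (hv : v ∈ S) :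
    sz p v ≤ S.card := by
  unfold sz
  have : desc p v ⊆ S := by
    intro w hw
    by_contra hws
    obtain ⟨i, hi⟩ := mem_desc.1 hw
    have : ∀ i, p^[i] w ∉ S := by
      intro i
      induction i with
      | zero => exact hws
      | succ i ih => rw [Function.iterate_succ_apply']; exact hS _ ih
    exact this i (hi ▸ hv)
  exact_mod_cast Finset.card_le_card this

end

/-- depth inside a side -/
def sh (τ j : ℕ) : ℕ := if j ≤ τ then j else τ + (j - τ + 1) / 2

/-- parent inside a side -/
def sp (τ j : ℕ) : ℕ := if j ≤ τ then j - 1 else τ + 2 * ((j - τ - 1) / 2)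

theorem sum_sh (τ b : ℕ) : 2 * ∑ j ∈ Finset.range (τ + 2 * b + 1), (sh τ j : ℤ) =
    τ * (τ + 1) + 4 * b * τ + 2 * b * (b + 1) := by
  induction b with
  | zero =>
    have h1 : ∀ j ∈ Finset.range (τ + 1), (sh τ j : ℤ) = j := by
      intro j hj
      rw [Finset.mem_range] at hj
      unfold sh; rw [if_pos (by omega)]
    have h2 := Finset.sum_range_id_mul_two (τ + 1)
    simp only [mul_zero, add_zero]
    rw [Finset.sum_congr rfl h1]
    zify at h2
    simp at h2 ⊢
    linarith
  | succ b ih =>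
    rw [show τ + 2 * (b + 1) + 1 = τ + 2 * b + 1 + 1 + 1 by ring, Finset.sum_range_succ,
      Finset.sum_range_succ]
    have h1 : sh τ (τ + 2 * b + 1) = τ + b + 1 := by
      unfold sh; rw [if_neg (by omega)]; omega
    have h2 : sh τ (τ + 2 * b + 1 + 1) = τ + b + 1 := by
      unfold sh; rw [if_neg (by omega)]; omega
    rw [h1, h2]
    push_cast
    linarith

/-- parent function of the comparison tree -/
def qp (n1 τ τ' k : ℕ) : ℕ :=
  if k < n1 then sp τ k else if k = n1 then 0 else n1 + sp τ' (k - n1)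

/-- depth function of the comparison tree -/
def qh (n1 τ τ' k : ℕ) : ℕ := if k < n1 then sh τ k else 1 + sh τ' (k - n1)

theorem sp_lt {τ j : ℕ} (hj : j ≠ 0) : sp τ j < j := by
  unfold sp; split_ifs <;> omega

theorem sp_zero {τ : ℕ} : sp τ 0 = 0 := by simp [sp]

theorem sh_sp {τ j : ℕ} (hj : j ≠ 0) : sh τ (sp τ j) + 1 = sh τ j := by
  unfold sp sh; split_ifs <;> omega

theorem qp_le (n1 τ τ' k : ℕ) : qp n1 τ τ' k ≤ k := by
  unfold qp
  split_ifs with h1 h2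
  · by_cases hk : k = 0
    · rw [hk, sp_zero]
    · exact (sp_lt hk).le
  · omega
  · have := sp_lt (τ := τ') (j := k - n1) (by omega); omega

/-- comparison tree -/
def qT (n n1 τ τ' : ℕ) : SimpleGraph (Fin n) :=
  SimpleGraph.fromRel (fun u v => qp n1 τ τ' u = v)

theorem qT_rooted {n n1 τ τ' : ℕ} (hn : 0 < n) (h1 : 0 < n1) :
    Rooted (qT n n1 τ τ') (⟨0, hn⟩ : Fin n)
      (fun v => ⟨qp n1 τ τ' v, (qp_le n1 τ τ' v).trans_lt v.2⟩) (fun v => qh n1 τ τ' v) := by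
  have hlt : ∀ k, k ≠ 0 → qp n1 τ τ' k < k := by
    intro k hk
    unfold qp
    split_ifs with h1 h2
    · exact sp_lt hk
    · omega
    · have := sp_lt (τ := τ') (j := k - n1) (by omega); omega
  have h00 : qp n1 τ τ' 0 = 0 := by have := qp_le n1 τ τ' 0; omega
  refine ⟨?_, ?_, ?_⟩
  · exact Fin.ext h00
  · rintro ⟨v, hv⟩ hne
    have hne' : v ≠ 0 := fun h0 => hne (Fin.ext h0)
    simp only [qp, qh]
    by_cases hv1 : v < n1
    · have h3 := sp_lt (τ := τ) hne'
      rw [if_pos hv1, if_pos hv1, if_pos (by omega)]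
      exact sh_sp hne'
    · rw [if_neg hv1, if_neg hv1]
      by_cases hv2 : v = n1
      · rw [if_pos hv2, if_pos h1, hv2]
        simp [sh]
      · rw [if_neg hv2, if_neg (by omega), Nat.add_sub_cancel_left]
        have := sh_sp (τ := τ') (j := v - n1) (by omega)
        omega
  · rintro ⟨u, hu⟩ ⟨v, hv⟩
    unfold qT
    rw [SimpleGraph.fromRel_adj]
    simp only [ne_eq, Fin.mk.injEq]
    by_cases hu0 : u = 0
    · subst hu0
      rw [h00]
      have := hlt v
      omega
    · have := hlt u hu0
      by_cases hv0 : v = 0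
      · subst hv0
        rw [h00]
        omega
      · have := hlt v hv0
        omega

theorem qT_ch {n n1 τ τ' : ℕ} (hn : 0 < n) {u v : Fin n} :
    u ∈ ch (fun v : Fin n => ⟨qp n1 τ τ' v, (qp_le n1 τ τ' v).trans_lt v.2⟩) (⟨0, hn⟩ : Fin n) v ↔
      (u : ℕ) ≠ 0 ∧ qp n1 τ τ' u = v := by
  rw [mem_ch, ne_eq, Fin.ext_iff, Fin.ext_iff]

theorem qT_degree {n n1 a b τ τ' : ℕ} (hn : 0 < n) (ha : 1 ≤ a) (h1 : n1 = τ + 2 * a + 1)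
    (hnn : n = n1 + (τ' + 2 * b + 1)) (v : Fin n) :
    (qT n n1 τ τ').degree v = 2 ↔ ((v : ℕ) < τ ∨ (n1 ≤ v ∧ (v : ℕ) < n1 + τ')) := by
  have R := qT_rooted (n := n) (n1 := n1) (τ := τ) (τ' := τ') hn (by omega)
  obtain ⟨v, hv⟩ := v
  have hsub : ∀ C : Finset (Fin n), (∀ u ∈ C, (u : ℕ) ≠ 0 ∧ qp n1 τ τ' u = v) →
      C.card ≤ (ch (fun v : Fin n => ⟨qp n1 τ τ' v, (qp_le n1 τ τ' v).trans_lt v.2⟩)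
        (⟨0, hn⟩ : Fin n) ⟨v, hv⟩).card := by
    intro C hC
    apply Finset.card_le_card
    intro u hu
    exact (qT_ch hn).2 (hC u hu)
  have hsup : ∀ C : Finset (Fin n), (∀ u : Fin n, (u : ℕ) ≠ 0 → qp n1 τ τ' u = v → u ∈ C) →
      (ch (fun v : Fin n => ⟨qp n1 τ τ' v, (qp_le n1 τ τ' v).trans_lt v.2⟩)
        (⟨0, hn⟩ : Fin n) ⟨v, hv⟩).card ≤ C.card := by
    intro C hC
    apply Finset.card_le_card
    intro u hu
    have := (qT_ch hn).1 hu
    exact hC u this.1 this.2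
  simp only
  by_cases hv0 : v = 0
  · subst hv0
    have hd := R.degree_c
    by_cases hτ : τ = 0
    · have := hsub {⟨1, by omega⟩, ⟨2, by omega⟩, ⟨n1, by omega⟩} (by
        intro u hu
        simp only [Finset.mem_insert, Finset.mem_singleton] at hu
        rcases hu with rfl | rfl | rfl <;> simp only [qp, sp] <;> split_ifs <;> omega)
      rw [Finset.card_insert_of_notMem, Finset.card_insert_of_notMem, Finset.card_singleton] at this
      · constructor <;> intro <;> omega
      · simp only [Finset.mem_singleton, Fin.mk.injEq]; omega
      · simp only [Finset.mem_insert, Finset.mem_singleton, Fin.mk.injEq]; omega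
    · have k1 := hsub {⟨1, by omega⟩, ⟨n1, by omega⟩} (by
        intro u hu
        simp only [Finset.mem_insert, Finset.mem_singleton] at hu
        rcases hu with rfl | rfl <;> simp only [qp, sp] <;> split_ifs <;> omega)
      have k2 := hsup {⟨1, by omega⟩, ⟨n1, by omega⟩} (by
        intro u hu
        simp only [Finset.mem_insert, Finset.mem_singleton, Fin.ext_iff]
        simp only [qp, sp]; split_ifs <;> omega)
      rw [Finset.card_pair (by simp only [ne_eq, Fin.mk.injEq]; omega)] at k1 k2
      constructor <;> intro <;> omega
  · have hd := R.degree_eq (v := ⟨v, hv⟩) (by simpa [Fin.ext_iff] using hv0)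
    by_cases hcond : v < τ ∨ (n1 ≤ v ∧ v < n1 + τ')
    · have k1 := hsub {⟨v + 1, by omega⟩} (by
        intro u hu
        simp only [Finset.mem_singleton] at hu
        subst hu
        simp only [qp, sp]; split_ifs <;> omega)
      have k2 := hsup {⟨v + 1, by omega⟩} (by
        intro u hu
        simp only [Finset.mem_singleton, Fin.ext_iff]
        simp only [qp, sp]; split_ifs <;> omega)
      rw [Finset.card_singleton] at k1 k2
      constructor <;> intro <;> omega
    · by_cases hbr : (v < τ + 2 * a ∧ (v - τ) % 2 = 0) ∨
        (n1 ≤ v ∧ v < n1 + τ' + 2 * b ∧ (v - n1 - τ') % 2 = 0)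
      · have k1 := hsub {⟨v + 1, by omega⟩, ⟨v + 2, by omega⟩} (by
          intro u hu
          simp only [Finset.mem_insert, Finset.mem_singleton] at hu
          rcases hu with rfl | rfl <;> simp only [qp, sp] <;> split_ifs <;> omega)
        rw [Finset.card_pair (by simp only [ne_eq, Fin.mk.injEq]; omega)] at k1
        constructor <;> intro <;> omega
      · have k2 := hsup ∅ (by
          rintro ⟨u, hun⟩ hu
          simp only [qp, sp] at *; split_ifs <;> omega)
        rw [Finset.card_empty] at k2
        constructor <;> intro <;> omega

theorem qT_count {n n1 a b τ τ' : ℕ} (hn : 0 < n) (ha : 1 ≤ a) (h1 : n1 = τ + 2 * a + 1)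
    (hnn : n = n1 + (τ' + 2 * b + 1)) : degreeTwoCount (qT n n1 τ τ') = τ + τ' := by
  unfold degreeTwoCount
  rw [← Finset.card_image_of_injective _ Fin.val_injective]
  have : (Finset.univ.filter fun v => (qT n n1 τ τ').degree v = 2).image Fin.val =
      Finset.range τ ∪ Finset.Ico n1 (n1 + τ') := by
    ext k
    simp only [Finset.mem_image, Finset.mem_filter, Finset.mem_univ, true_and, Finset.mem_union,
      Finset.mem_range, Finset.mem_Ico]
    constructor
    · rintro ⟨v, hv, rfl⟩
      exact (qT_degree hn ha h1 hnn v).1 hv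
    · intro hk
      exact ⟨⟨k, by omega⟩, (qT_degree hn ha h1 hnn _).2 hk, rfl⟩
  rw [this, Finset.card_union_of_disjoint]
  · simp
  · rw [Finset.disjoint_left]
    intro k hk hk'
    rw [Finset.mem_range] at hk
    rw [Finset.mem_Ico] at hk'
    omega

theorem qT_mostar {n n1 a b τ τ' : ℕ} (hn : 0 < n) (h1 : n1 = τ + 2 * a + 1)
    (hnn : n = n1 + (τ' + 2 * b + 1)) (hbal1 : τ' + 2 * b + 1 ≤ n1)
    (hbal2 : n1 ≤ τ' + 2 * b + 1 + 2) :
    2 * (mostar (qT n n1 τ τ') : ℤ) = 2 * n * (n - 1) -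
      ((n : ℤ) ^ 2 - n % 2 - 4 * (a : ℤ) ^ 2 - 4 * (b : ℤ) ^ 2) := by
  have R := qT_rooted (n := n) (n1 := n1) (τ := τ) (τ' := τ') hn (by omega)
  have hc : ∀ v ≠ (⟨0, hn⟩ : Fin n),
      2 * sz (fun v : Fin n => ⟨qp n1 τ τ' v, (qp_le n1 τ τ' v).trans_lt v.2⟩) v ≤
        Fintype.card (Fin n) := by
    rintro ⟨v, hv⟩ hne
    have hne' : v ≠ 0 := fun h0 => hne (Fin.ext h0)
    rw [Fintype.card_fin]
    by_cases hv1 : v < n1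
    · have k := Rooted.sz_le_of_closed
        (p := (fun v : Fin n => ⟨qp n1 τ τ' v, (qp_le n1 τ τ' v).trans_lt v.2⟩))
        (S := Finset.univ.filter fun w : Fin n => (w : ℕ) ∈ Finset.Ico 1 n1) (v := ⟨v, hv⟩) (by
          rintro ⟨w, hw⟩
          simp only [Finset.mem_filter, Finset.mem_univ, true_and, Finset.mem_Ico]
          intro hw1
          simp only [qp, sp]; split_ifs <;> omega)
        (by simp only [Finset.mem_filter, Finset.mem_univ, true_and, Finset.mem_Ico]; omega)
      have k2 : (Finset.univ.filter fun w : Fin n => (w : ℕ) ∈ Finset.Ico 1 n1).card ≤ n1 - 1 := by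
        rw [← Finset.card_image_of_injective _ Fin.val_injective]
        calc _ ≤ (Finset.Ico 1 n1).card := Finset.card_le_card (by
              intro k hk
              rw [Finset.mem_image] at hk
              obtain ⟨w, hw, rfl⟩ := hk
              exact (Finset.mem_filter.1 hw).2)
          _ = _ := by simp
      omega
    · have k := Rooted.sz_le_of_closed
        (p := (fun v : Fin n => ⟨qp n1 τ τ' v, (qp_le n1 τ τ' v).trans_lt v.2⟩))
        (S := Finset.univ.filter fun w : Fin n => (w : ℕ) ∈ Finset.Ico n1 n) (v := ⟨v, hv⟩) (by
          rintro ⟨w, hw⟩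
          simp only [Finset.mem_filter, Finset.mem_univ, true_and, Finset.mem_Ico]
          intro hw1
          simp only [qp, sp]; split_ifs <;> omega)
        (by simp only [Finset.mem_filter, Finset.mem_univ, true_and, Finset.mem_Ico]; omega)
      have k2 : (Finset.univ.filter fun w : Fin n => (w : ℕ) ∈ Finset.Ico n1 n).card ≤ n - n1 := by
        rw [← Finset.card_image_of_injective _ Fin.val_injective]
        calc _ ≤ (Finset.Ico n1 n).card := Finset.card_le_card (by
              intro k hk
              rw [Finset.mem_image] at hk
              obtain ⟨w, hw, rfl⟩ := hk
              exact (Finset.mem_filter.1 hw).2)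
          _ = _ := by simp
      omega
  have hm := R.mostar_centroid hc
  have hz : qh n1 τ τ' 0 = 0 := by
    unfold qh sh; rw [if_pos (by omega), if_pos (by omega)]
  rw [R.sum_h hz, Fintype.card_fin,
    Fin.sum_univ_eq_sum_range (fun k => (qh n1 τ τ' k : ℤ)) n] at hm
  have hsplit : ∑ k ∈ Finset.range n, (qh n1 τ τ' k : ℤ) =
      ∑ k ∈ Finset.range (τ + 2 * a + 1), (sh τ k : ℤ) +
        (∑ k ∈ Finset.range (τ' + 2 * b + 1), (sh τ' k : ℤ) + (τ' + 2 * b + 1)) := by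
    rw [hnn, Finset.sum_range_add, ← h1]
    congr 1
    · apply Finset.sum_congr rfl
      intro k hk
      rw [Finset.mem_range] at hk
      unfold qh; rw [if_pos hk]
    · have : ∀ k ∈ Finset.range (τ' + 2 * b + 1), (qh n1 τ τ' (n1 + k) : ℤ) = sh τ' k + 1 := by
        intro k hk
        unfold qh; rw [if_neg (by omega), Nat.add_sub_cancel_left]; push_cast; ring
      rw [Finset.sum_congr rfl this, Finset.sum_add_distrib]
      simp
  have s1 := sum_sh τ a
  have s2 := sum_sh τ' b
  have hK := num_K (n := n) (s := τ + 2 * a) (S := τ' + 2 * b + 1) (by rw [hnn, h1]; push_cast; ring)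
    (by omega) (by omega)
  rw [hm, hK, hsplit]
  linarith

theorem sum_tt {V : Type*} [Fintype V] {G : SimpleGraph V} {c : V} {p : V → V} {h : V → ℕ}
    (R : Rooted G c p h) : tt G p c = degreeTwoCount G := by
  unfold tt degreeTwoCount
  rw [R.desc_root, Finset.card_filter]
  push_cast
  rfl

theorem main_thm (n t : ℕ) (ht : t ≤ n - 4) (hn : 4 ≤ n)
    (heven : Even (n - t))
    (T : SimpleGraph (Fin n)) (hT : T.IsTree) (h2 : degreeTwoCount T = t)
    (hmin : ∀ T' : SimpleGraph (Fin n), T'.IsTree → degreeTwoCount T' = t →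
      mostar T ≤ mostar T') :
    Nonempty (T ≃g catC n ((n - t - 2 + 3) / 4) ((n - t - 2) / 4)) := by
  obtain ⟨q, hq⟩ := heven
  obtain ⟨a, ha⟩ : ∃ a, a = (n - t - 2 + 3) / 4 := ⟨_, rfl⟩
  obtain ⟨b, hb⟩ : ∃ b, b = (n - t - 2) / 4 := ⟨_, rfl⟩
  rw [← ha, ← hb]
  have hab : b ≤ a := by omega
  have hab' : a ≤ b + 1 := by omega
  have hsum : n = t + 2 * (a + b) + 2 := by omega
  have ha1 : 1 ≤ a := by omega
  obtain ⟨τ, hτ⟩ : ∃ τ, τ = (t + 1 - (a - b)) / 2 := ⟨_, rfl⟩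
  obtain ⟨τ', hτ'⟩ : ∃ τ', τ' = t - τ := ⟨_, rfl⟩
  have hn0 : 0 < n := by omega
  have R' := qT_rooted (n := n) (n1 := τ + 2 * a + 1) (τ := τ) (τ' := τ') hn0 (by omega)
  have hcount := qT_count (n := n) (b := b) (τ := τ) (τ' := τ') hn0 ha1 rfl (by omega)
  have hmost := qT_mostar (n := n) (a := a) (b := b) (τ := τ) (τ' := τ') hn0 rfl (by omega)
    (by omega) (by omega)
  have hle := hmin _ R'.isTree (by omega)
  haveI : Nonempty (Fin n) := ⟨⟨0, hn0⟩⟩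
  obtain ⟨c, p, h, R, hc⟩ := exists_centroid hT
  have hm := R.mostar_centroid hc
  rw [Fintype.card_fin] at hm
  have hleZ : (mostar T : ℤ) ≤ mostar (qT n (τ + 2 * a + 1) τ τ') := by exact_mod_cast hle
  refine R.iso (R.root hc (n := n) (by rw [Fintype.card_fin]) (by exact_mod_cast hn) hab hab'
    (by omega) ?_ ?_)
  · rw [sum_tt R, h2]
    omega
  · linarith

end MT

/-- if n - t is even, the tree minimizing the Mostar index among trees of
order n with exactly t vertices of degree two (0 ≤ t ≤ n-4) is
C_{n,⌈(n-t-2)/4⌉,⌊(n-t-2)/4⌋}.  (In ℕ, ⌈m/4⌉ = (m+3)/4.) -/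
theorem min_mostar_degree_two_even (n t : ℕ) (ht : t ≤ n - 4) (hn : 4 ≤ n)
    (heven : Even (n - t))
    (T : SimpleGraph (Fin n)) (hT : T.IsTree) (h2 : degreeTwoCount T = t)
    (hmin : ∀ T' : SimpleGraph (Fin n), T'.IsTree → degreeTwoCount T' = t →
      mostar T ≤ mostar T') :
    Nonempty (T ≃g catC n ((n - t - 2 + 3) / 4) ((n - t - 2) / 4)) := by
  exact MT.main_thm n t ht hn heven T hT h2 hmin
end

section
/- Let n, r, k be integers with either k = 1 and 2 ≤ r ≤ n−3, or k ≥ 2, r ≥ 2 and kr ≤ n−2. Let T be a tree of order n with exactly k pendent paths of length r that has the maximum Mostar index among all such trees. Then T is isomorphic to S^r_{n,k}. -/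
open Finset SimpleGraph

open scoped Classical

section helpers
variable {V : Type*} {G : SimpleGraph V}

theorem exists_avoid (hG : G.Connected) {x u v : V} (h : G.dist x u < G.dist x v) :
    ∃ p : G.Walk x u, v ∉ p.support := by
  obtain ⟨p, hp⟩ := hG.exists_walk_length_eq_dist x u
  refine ⟨p, fun hv => ?_⟩
  have h1 := G.dist_le (p.takeUntil v hv)
  have h2 := p.length_takeUntil_le_length hv
  omega

theorem tree_cross (hT : G.IsTree) {u v x y : V} (huv : G.Adj u v) (hxy : G.Adj x y)
    (h1 : G.dist x u < G.dist x v) (h2 : G.dist y v < G.dist y u) : x = u ∧ y = v := by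
  obtain ⟨p, hp⟩ := exists_avoid hT.connected h1
  obtain ⟨q, hq⟩ := exists_avoid hT.connected h2
  have hb := isBridge_iff_forall_walk_mem_edges.1
    (isAcyclic_iff_forall_adj_isBridge.1 hT.isAcyclic huv) (p.reverse.append (Walk.cons hxy q))
  simp only [Walk.edges_append, Walk.edges_reverse, Walk.edges_cons, List.mem_append,
    List.mem_reverse, List.mem_cons] at hb
  rcases hb with hb | hb | hb
  · exact absurd (p.snd_mem_support_of_mem_edges hb) hp
  · rcases Sym2.eq_iff.1 hb with ⟨rfl, rfl⟩ | ⟨rfl, rfl⟩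
    · exact ⟨rfl, rfl⟩
    · simp at h1
  · exact absurd (q.fst_mem_support_of_mem_edges hb) hq

theorem tree_closer_unique (hT : G.IsTree) {u a b w : V} (ha : G.Adj u a) (hb : G.Adj u b)
    (h1 : G.dist w a < G.dist w u) (h2 : G.dist w b < G.dist w u) : a = b := by
  obtain ⟨p, hp⟩ := exists_avoid hT.connected h1
  obtain ⟨q, hq⟩ := exists_avoid hT.connected h2
  have hb := isBridge_iff_forall_walk_mem_edges.1
    (isAcyclic_iff_forall_adj_isBridge.1 hT.isAcyclic hb) (Walk.cons ha (p.reverse.append q))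
  simp only [Walk.edges_append, Walk.edges_reverse, Walk.edges_cons, List.mem_append,
    List.mem_reverse, List.mem_cons] at hb
  rcases hb with hb | hb | hb
  · rcases Sym2.eq_iff.1 hb with ⟨_, h⟩ | ⟨h, h'⟩
    · exact h.symm
    · rw [← h, h']
  · exact absurd (p.fst_mem_support_of_mem_edges hb) hp
  · exact absurd (q.fst_mem_support_of_mem_edges hb) hq

theorem exists_closer (hG : G.Connected) {w v : V} (h : w ≠ v) :
    ∃ x, G.Adj v x ∧ G.dist w v = G.dist w x + 1 := by
  obtain ⟨p, hp⟩ := hG.exists_walk_length_eq_dist v w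
  cases p with
  | nil => exact absurd rfl h
  | cons hadj q =>
    rename_i x
    refine ⟨x, hadj, ?_⟩
    have h1 := G.dist_le q
    have h2 := hG.dist_triangle (u := v) (v := x) (w := w)
    have h3 := (dist_eq_one_iff_adj).2 hadj
    rw [Walk.length_cons] at hp
    rw [G.dist_comm (u := w), G.dist_comm (u := w)]
    omega

/-- the edge `e` separates `w` from `c` -/
def EdgeSep (G : SimpleGraph V) (w c : V) (e : Sym2 V) : Prop :=
  ∃ u v, e = s(u, v) ∧ G.dist w u < G.dist w v ∧ G.dist c v < G.dist c u

theorem sep_adj_iff (hT : G.IsTree) {c u v w : V} (huv : G.Adj u v)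
    (h : G.dist c u < G.dist c v) : EdgeSep G w c s(u, v) ↔ G.dist w v < G.dist w u := by
  constructor
  · rintro ⟨a, b, hab, h1, h2⟩
    rcases Sym2.eq_iff.1 hab with ⟨rfl, rfl⟩ | ⟨rfl, rfl⟩
    · omega
    · exact h1
  · intro h1
    exact ⟨v, u, Sym2.eq_swap, h1, h⟩

theorem sep_insert (hT : G.IsTree) {c w w' : V} (hadj : G.Adj w' w)
    (hd : G.dist c w' = G.dist c w + 1) {e : Sym2 V} (he : e ∈ G.edgeSet) :
    EdgeSep G w' c e ↔ e = s(w', w) ∨ EdgeSep G w c e := by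
  induction e with | _ u v =>
  have huv : G.Adj u v := he
  wlog h : G.dist c u < G.dist c v generalizing u v
  · have := this v u (by rwa [Sym2.eq_swap]) huv.symm
      (by have := hT.dist_ne_of_adj c huv; omega)
    rwa [Sym2.eq_swap]
  rw [sep_adj_iff hT huv h, sep_adj_iff hT huv h]
  constructor
  · intro h1
    by_cases h2 : G.dist w v < G.dist w u
    · exact Or.inr h2
    · have := tree_cross hT huv hadj.symm (by have := hT.dist_ne_of_adj w huv; omega) h1
      rw [this.1, this.2, Sym2.eq_swap]; exact Or.inl rfl
  · rintro (h1 | h1)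
    · rcases Sym2.eq_iff.1 h1 with ⟨rfl, rfl⟩ | ⟨rfl, rfl⟩
      · omega
      · simp [dist_eq_one_iff_adj.2 huv.symm]
    · by_contra h2
      have := tree_cross hT huv hadj (by have := hT.dist_ne_of_adj w' huv; omega) h1
      rw [this.1, this.2] at hd; omega

variable [Fintype V]

theorem sep_card (hT : G.IsTree) (c : V) : ∀ (m : ℕ) (w : V), G.dist c w = m →
    (G.edgeFinset.filter fun e => EdgeSep G w c e).card = m := by
  intro m
  induction m with
  | zero =>
    intro w hw
    have : c = w := hT.connected.dist_eq_zero_iff.1 hw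
    subst this
    rw [Finset.card_eq_zero, Finset.filter_eq_empty_iff]
    rintro e - ⟨u, v, -, h1, h2⟩
    omega
  | succ m ih =>
    intro w hw
    have hne : c ≠ w := by rintro rfl; simp at hw
    obtain ⟨x, hx, hd⟩ := exists_closer hT.connected hne
    have hih := ih x (by omega)
    have : (G.edgeFinset.filter fun e => EdgeSep G w c e) =
        insert s(w, x) (G.edgeFinset.filter fun e => EdgeSep G x c e) := by
      ext e
      simp only [Finset.mem_filter, Finset.mem_insert, mem_edgeFinset]
      constructor
      · rintro ⟨he, hs⟩
        rcases (sep_insert hT hx hd he).1 hs with h | h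
        · exact Or.inl h
        · exact Or.inr ⟨he, h⟩
      · rintro (rfl | ⟨he, h⟩)
        · exact ⟨hx, (sep_insert hT hx hd hx).2 (Or.inl rfl)⟩
        · exact ⟨he, (sep_insert hT hx hd he).2 (Or.inr h)⟩
    rw [this, Finset.card_insert_of_notMem, hih]
    simp only [Finset.mem_filter, not_and]
    intro _ h
    rw [Sym2.eq_swap, sep_adj_iff hT hx.symm (by omega)] at h
    simp at h

/-- total distance -/
noncomputable def totDist (G : SimpleGraph V) (c : V) : ℕ := ∑ w, G.dist c w

theorem sum_sep (hT : G.IsTree) (c : V) :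
    ∑ e ∈ G.edgeFinset, (Finset.univ.filter fun w => EdgeSep G w c e).card = totDist G c := by
  simp only [Finset.card_filter]
  rw [Finset.sum_comm]
  refine Finset.sum_congr rfl fun w _ => ?_
  rw [← Finset.card_filter]
  exact sep_card hT c _ w rfl

theorem card_sides (hT : G.IsTree) {u v : V} (huv : G.Adj u v) :
    (Finset.univ.filter fun w => G.dist w u < G.dist w v).card +
      (Finset.univ.filter fun w => G.dist w v < G.dist w u).card = Fintype.card V := by
  rw [← Finset.card_univ, ← Finset.card_filter_add_card_filter_not (s := Finset.univ)
    (fun w => G.dist w u < G.dist w v)]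
  congr 2
  ext w
  simp only [Finset.mem_filter, Finset.mem_univ, true_and]
  have := hT.dist_ne_of_adj w huv
  omega

theorem trans_diff (hT : G.IsTree) {u v : V} (huv : G.Adj u v) :
    totDist G u + (Finset.univ.filter fun w => G.dist w u < G.dist w v).card =
    totDist G v + (Finset.univ.filter fun w => G.dist w v < G.dist w u).card := by
  unfold totDist
  rw [Finset.card_filter, Finset.card_filter, ← Finset.sum_add_distrib, ← Finset.sum_add_distrib]
  refine Finset.sum_congr rfl fun w _ => ?_
  have := hT.dist_eq_dist_add_one_of_adj w huv
  rw [G.dist_comm (u := u), G.dist_comm (u := v)]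
  split_ifs <;> omega

theorem psi_ge (hT : G.IsTree) (c : V) {e : Sym2 V} (he : e ∈ G.edgeSet) :
    (Fintype.card V : ℤ) - 2 * (Finset.univ.filter fun w => EdgeSep G w c e).card ≤ mostarPsi G e := by
  induction e with | _ u v =>
  have huv : G.Adj u v := he
  wlog h : G.dist c u < G.dist c v generalizing u v
  · have := this v u (by rwa [Sym2.eq_swap]) huv.symm
      (by have := hT.dist_ne_of_adj c huv; omega)
    rwa [Sym2.eq_swap]
  simp only [sep_adj_iff hT huv h]
  have := card_sides hT huv
  simp only [mostarPsi, Sym2.lift_mk]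
  omega

theorem trans_mono (hT : G.IsTree) {c : V} (hc : ∀ x, totDist G c ≤ totDist G x) :
    ∀ (m : ℕ) (u v : V), G.Adj u v → G.dist c u = m → G.dist c u < G.dist c v →
      totDist G u ≤ totDist G v := by
  intro m
  induction m with
  | zero =>
    intro u v _ h0 _
    rw [← hT.connected.dist_eq_zero_iff.1 h0]
    exact hc v
  | succ m ih =>
    intro u v huv h0 h
    have hne : c ≠ u := by rintro rfl; simp at h0
    obtain ⟨x, hx, hd⟩ := exists_closer hT.connected hne
    have h1 := ih x u hx.symm (by omega) (by omega)
    have h2 := trans_diff hT huv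
    have h3 := trans_diff hT hx.symm
    have h4 := card_sides hT huv
    have h5 := card_sides hT hx.symm
    have h6 : (Finset.univ.filter fun w => G.dist w v < G.dist w u).card ≤
        (Finset.univ.filter fun w => G.dist w u < G.dist w x).card := by
      refine Finset.card_le_card fun w => ?_
      simp only [Finset.mem_filter, Finset.mem_univ, true_and]
      intro hw
      by_contra hcon
      have := hT.dist_ne_of_adj w hx
      have hxv := tree_closer_unique hT hx huv (w := w) (by omega) hw
      rw [hxv] at hd; omega
    omega

theorem psi_eq (hT : G.IsTree) {c : V} (hc : ∀ x, totDist G c ≤ totDist G x)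
    {e : Sym2 V} (he : e ∈ G.edgeSet) :
    (mostarPsi G e : ℤ) =
    (Fintype.card V : ℤ) - 2 * (Finset.univ.filter fun w => EdgeSep G w c e).card := by
  induction e with | _ u v =>
  have huv : G.Adj u v := he
  wlog h : G.dist c u < G.dist c v generalizing u v
  · have := this v u (by rwa [Sym2.eq_swap]) huv.symm
      (by have := hT.dist_ne_of_adj c huv; omega)
    rwa [Sym2.eq_swap]
  have h1 := trans_mono hT hc _ u v huv rfl h
  simp only [sep_adj_iff hT huv h]
  have := card_sides hT huv
  have := trans_diff hT huv
  simp only [mostarPsi, Sym2.lift_mk]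
  omega

theorem mostar_ge (hT : G.IsTree) (c : V) :
    (G.edgeFinset.card : ℤ) * Fintype.card V - 2 * totDist G c ≤ mostar G := by
  have h : ∑ e ∈ G.edgeFinset, ((Fintype.card V : ℤ) -
      2 * (Finset.univ.filter fun w => EdgeSep G w c e).card) ≤ ∑ e ∈ G.edgeFinset, (mostarPsi G e : ℤ) :=
    Finset.sum_le_sum fun e he => psi_ge hT c (mem_edgeFinset.1 he)
  rw [Finset.sum_sub_distrib, ← Finset.mul_sum] at h
  have h2 := sum_sep hT c
  rw [← h2]
  unfold mostar
  push_cast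
  simpa using h

theorem mostar_eq (hT : G.IsTree) {c : V} (hc : ∀ x, totDist G c ≤ totDist G x) :
    (mostar G : ℤ) = (G.edgeFinset.card : ℤ) * Fintype.card V - 2 * totDist G c := by
  have h : ∑ e ∈ G.edgeFinset, ((Fintype.card V : ℤ) -
      2 * (Finset.univ.filter fun w => EdgeSep G w c e).card) = ∑ e ∈ G.edgeFinset, (mostarPsi G e : ℤ) :=
    Finset.sum_congr rfl fun e he => (psi_eq hT hc (mem_edgeFinset.1 he)).symm
  rw [Finset.sum_sub_distrib, ← Finset.mul_sum] at h
  have h2 := sum_sep hT c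
  rw [← h2]
  unfold mostar
  push_cast
  simpa using h.symm

/-- The maximality comparison in terms of total distances. -/
theorem trans_le_of_mostar_le {S : SimpleGraph V} (hT : G.IsTree) (hS : S.IsTree)
    (h : mostar S ≤ mostar G) {c : V} (hc : ∀ x, totDist G c ≤ totDist G x) (c' : V) :
    totDist G c ≤ totDist S c' := by
  have h1 := mostar_eq hT hc
  have h2 := mostar_ge hS c'
  have h3 := hT.card_edgeFinset
  have h4 := hS.card_edgeFinset
  have h5 : S.edgeFinset.card = G.edgeFinset.card := by omega
  rw [h5] at h2
  omega
end helpers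

section legs
variable {V : Type*} [Fintype V] {G : SimpleGraph V}

/-- pendent path, indexed by naturals -/
structure Leg (G : SimpleGraph V) (r : ℕ) (u : ℕ → V) : Prop where
  adj : ∀ i, i < r → G.Adj (u i) (u (i + 1))
  inj : ∀ i j, i ≤ r → j ≤ r → u i = u j → i = j
  dzero : G.degree (u 0) = 1
  dlast : 2 ≤ G.degree (u r)
  dmid : ∀ i, 0 < i → i < r → G.degree (u i) = 2

theorem Leg.nb_zero {r : ℕ} {u : ℕ → V} (h : Leg G r u) (hr : 0 < r) {x : V}
    (hx : G.Adj (u 0) x) : x = u 1 := by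
  obtain ⟨y, hy⟩ := Finset.card_eq_one.1 h.dzero
  have h1 : x ∈ G.neighborFinset (u 0) := by simpa using hx
  have h2 : u 1 ∈ G.neighborFinset (u 0) := by simpa using h.adj 0 hr
  rw [hy, Finset.mem_singleton] at h1 h2
  rw [h1, h2]

theorem two_nb {v a b x : V} (hd : G.degree v ≤ 2) (ha : G.Adj v a) (hb : G.Adj v b) (hab : a ≠ b)
    (hx : G.Adj v x) : x = a ∨ x = b := by
  by_contra hcon
  push Not at hcon
  have : ({x, a, b} : Finset V) ⊆ G.neighborFinset v := by
    intro y hy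
    simp only [Finset.mem_insert, Finset.mem_singleton] at hy
    rw [mem_neighborFinset]
    rcases hy with rfl | rfl | rfl <;> assumption
  have h2 := Finset.card_le_card this
  rw [Finset.card_eq_three.2 ⟨x, a, b, hcon.1, hcon.2, hab, rfl⟩, card_neighborFinset_eq_degree] at h2
  omega

theorem Leg.nb_mid {r : ℕ} {u : ℕ → V} (h : Leg G r u) {i : ℕ} (hi : i + 1 < r) {x : V}
    (hx : G.Adj (u (i + 1)) x) : x = u i ∨ x = u (i + 2) :=
  two_nb (h.dmid (i + 1) (by omega) hi).le (h.adj i (by omega)).symm (h.adj (i + 1) hi)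
    (fun he => by have := h.inj i (i + 2) (by omega) (by omega) he; omega) hx

theorem Leg.dist_step {r : ℕ} {u : ℕ → V} (h : Leg G r u) (hG : G.Connected) {w : V}
    (hw : ∀ i, i < r → w ≠ u i) : ∀ j, j < r → G.dist w (u j) = G.dist w (u (j + 1)) + 1 := by
  intro j
  induction j with
  | zero =>
    intro hj
    obtain ⟨x, hx, hd⟩ := exists_closer hG (hw 0 hj)
    rw [hd, h.nb_zero hj hx]
  | succ j ih =>
    intro hj
    have := ih (by omega)
    obtain ⟨x, hx, hd⟩ := exists_closer hG (hw (j + 1) hj)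
    rcases h.nb_mid hj hx with rfl | rfl
    · omega
    · exact hd

theorem Leg.dist_out {r : ℕ} {u : ℕ → V} (h : Leg G r u) (hG : G.Connected) {w : V}
    (hw : ∀ i, i < r → w ≠ u i) {j : ℕ} (hj : j ≤ r) :
    G.dist w (u j) = G.dist w (u r) + (r - j) := by
  induction hj using Nat.decreasingInduction with
  | self => simp
  | of_succ k hk ih =>
    rw [h.dist_step hG hw k hk, ih]; omega

theorem Leg.sub {r : ℕ} {u : ℕ → V} (h : Leg G r u) {j : ℕ} (hj : 0 < j) (hjr : j ≤ r) :
    Leg G j u where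
  adj i hi := h.adj i (by omega)
  inj a b ha hb := h.inj a b (by omega) (by omega)
  dzero := h.dzero
  dlast := by
    rcases hjr.lt_or_eq with h1 | rfl
    · exact (h.dmid j hj h1).ge
    · exact h.dlast
  dmid i h0 hi := h.dmid i h0 (by omega)

theorem Leg.dist_in {r : ℕ} {u : ℕ → V} (h : Leg G r u) (hG : G.Connected) {i j : ℕ}
    (hij : i ≤ j) (hj : j ≤ r) : G.dist (u j) (u i) = j - i := by
  rcases Nat.eq_zero_or_pos j with rfl | h0
  · obtain rfl : i = 0 := by omega
    simp
  · have := (h.sub h0 hj).dist_out hG (w := u j)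
      (fun k hk he => by have := h.inj j k hj (by omega) he; omega) hij
    simpa using this

theorem Leg.dist_in' {r : ℕ} {u : ℕ → V} (h : Leg G r u) (hG : G.Connected) {i j : ℕ}
    (hi : i ≤ r) (hj : j ≤ r) : G.dist (u j) (u i) = (j - i) + (i - j) := by
  rcases le_total i j with h1 | h1
  · rw [h.dist_in hG h1 hj]; omega
  · rw [G.dist_comm, h.dist_in hG h1 hi]; omega

theorem Leg.totDist_eq {r : ℕ} {u : ℕ → V} (h : Leg G r u) (hG : G.Connected) {j : ℕ}
    (hj : j ≤ r) :
    totDist G (u j) + ∑ i ∈ Finset.range r, (r - i) =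
      totDist G (u r) + (∑ i ∈ Finset.range r, ((j - i) + (i - j)) +
        (Fintype.card V - r) * (r - j)) := by
  have hinj : Set.InjOn u (Finset.range r : Set ℕ) := by
    intro a ha b hb hab
    simp only [Finset.coe_range, Set.mem_Iio] at ha hb
    exact h.inj a b ha.le hb.le hab
  have hcard : ((Finset.range r).image u).card = r := by
    rw [Finset.card_image_of_injOn hinj, Finset.card_range]
  have hsplit : ∀ c, totDist G c = ∑ i ∈ Finset.range r, G.dist c (u i) +
      ∑ w ∈ ((Finset.range r).image u)ᶜ, G.dist c w := by
    intro c
    rw [totDist, ← Finset.sum_add_sum_compl ((Finset.range r).image u), Finset.sum_image hinj]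
  have h1 : ∀ j, j ≤ r → ∑ i ∈ Finset.range r, G.dist (u j) (u i) =
      ∑ i ∈ Finset.range r, ((j - i) + (i - j)) := by
    intro j hj
    refine Finset.sum_congr rfl fun i hi => ?_
    rw [h.dist_in' hG (by simp at hi; omega) hj]
  have h2 : ∑ w ∈ ((Finset.range r).image u)ᶜ, G.dist (u j) w =
      ∑ w ∈ ((Finset.range r).image u)ᶜ, G.dist (u r) w + (Fintype.card V - r) * (r - j) := by
    rw [← hcard, ← Finset.card_compl, hcard, ← smul_eq_mul, ← Finset.sum_const,
      ← Finset.sum_add_distrib]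
    refine Finset.sum_congr rfl fun w hw => ?_
    rw [G.dist_comm, G.dist_comm (u := u r)]
    refine h.dist_out hG (fun i hi he => ?_) hj
    rw [Finset.mem_compl] at hw
    exact hw (Finset.mem_image.2 ⟨i, by simpa using hi, he.symm⟩)
  have h3 : ∑ i ∈ Finset.range r, ((r - i) + (i - r)) = ∑ i ∈ Finset.range r, (r - i) :=
    Finset.sum_congr rfl fun i hi => by simp at hi; omega
  rw [hsplit (u j), hsplit (u r), h1 j hj, h1 r le_rfl, h2, h3]
  ring

theorem Leg.ext {r : ℕ} {u u' : ℕ → V} (h : Leg G r u) (h' : Leg G r u') (h0 : u 0 = u' 0) :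
    ∀ i, i ≤ r → u i = u' i := by
  have key : ∀ i, i + 1 ≤ r → u i = u' i ∧ u (i + 1) = u' (i + 1) := by
    intro i
    induction i with
    | zero =>
      intro hi
      refine ⟨h0, h'.nb_zero hi ?_⟩
      rw [← h0]; exact h.adj 0 hi
    | succ i ih =>
      intro hi
      obtain ⟨h1, h2⟩ := ih (by omega)
      refine ⟨h2, ?_⟩
      have h3 := h.adj (i + 1) hi
      rw [h2] at h3
      rcases h'.nb_mid hi h3 with h4 | h4
      · rw [← h1] at h4
        have := h.inj _ _ (by omega) (by omega) h4
        omega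
      · exact h4
  intro i hi
  cases i with
  | zero => exact h0
  | succ i => exact (key i hi).2

theorem closed_univ (hG : G.Connected) (X : Finset V) {a : V} (ha : a ∈ X)
    (hX : ∀ x ∈ X, ∀ y, G.Adj x y → y ∈ X) : X = Finset.univ := by
  rw [Finset.eq_univ_iff_forall]
  intro y
  obtain ⟨p⟩ := hG.preconnected a y
  induction p with
  | nil => exact ha
  | cons hadj _ ih => exact ih (hX _ ha _ hadj)

theorem Leg.disjoint {r : ℕ} {u u' : ℕ → V} (h : Leg G r u) (h' : Leg G r u') (hG : G.Connected)
    (hcard : 2 * r < Fintype.card V) (hr : 0 < r) :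
    ∀ a b, a ≤ r → b < r → u a = u' b → u 0 = u' 0 := by
  intro a
  induction a with
  | zero =>
    intro b _ hb hab
    rcases Nat.eq_zero_or_pos b with rfl | h0
    · exact hab
    · have h1 := h'.dmid b h0 hb
      rw [← hab, h.dzero] at h1
      omega
  | succ a ih =>
    intro b ha hb hab
    cases b with
    | zero =>
      have h1 := h'.dzero
      have h2 := (h.sub (Nat.succ_pos a) ha).dlast
      rw [hab] at h2
      omega
    | succ b =>
      by_cases hc : u a = u' b
      · exact ih b (by omega) (by omega) hc
      exfalso
      have hX := closed_univ hG ((Finset.range (a + 2)).image u ∪ (Finset.range (b + 1)).image u')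
        (a := u 0) (Finset.mem_union_left _ (Finset.mem_image_of_mem _ (by simp))) (by
        have hu : ∀ i, i < a + 2 → u i ∈
            (Finset.range (a + 2)).image u ∪ (Finset.range (b + 1)).image u' := fun i hi =>
          Finset.mem_union_left _ (Finset.mem_image_of_mem _ (by simpa using hi))
        have hu' : ∀ i, i < b + 2 → u' i ∈
            (Finset.range (a + 2)).image u ∪ (Finset.range (b + 1)).image u' := by
          intro i hi
          by_cases hi2 : i = b + 1
          · rw [hi2, ← hab]; exact hu _ (by omega)
          · exact Finset.mem_union_right _ (Finset.mem_image_of_mem _ (by simp; omega))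
        intro x hx y hxy
        rw [Finset.mem_union, Finset.mem_image, Finset.mem_image] at hx
        rcases hx with ⟨i, hi, rfl⟩ | ⟨i, hi, rfl⟩
        · rw [Finset.mem_range] at hi
          by_cases hia : i = a + 1
          · subst hia
            have h1 : G.Adj (u (a + 1)) (u a) := (h.adj a (by omega)).symm
            have h2 : G.Adj (u (a + 1)) (u' b) := by
              rw [hab]; exact (h'.adj b (by omega)).symm
            have h3 : G.degree (u (a + 1)) ≤ 2 := by
              rw [hab]; exact (h'.dmid (b + 1) (by omega) hb).le
            rcases two_nb h3 h1 h2 hc hxy with rfl | rfl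
            · exact hu _ (by omega)
            · exact hu' _ (by omega)
          · cases i with
            | zero => rw [h.nb_zero hr hxy]; exact hu _ (by omega)
            | succ i =>
              rcases h.nb_mid (by omega) hxy with rfl | rfl
              · exact hu _ (by omega)
              · exact hu _ (by omega)
        · rw [Finset.mem_range] at hi
          cases i with
          | zero => rw [h'.nb_zero hr hxy]; exact hu' _ (by omega)
          | succ i =>
            rcases h'.nb_mid (by omega) hxy with rfl | rfl
            · exact hu' _ (by omega)
            · exact hu' _ (by omega))
      have h1 := Finset.card_union_le ((Finset.range (a + 2)).image u)
        ((Finset.range (b + 1)).image u')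
      rw [hX, Finset.card_univ] at h1
      have h2 := Finset.card_image_le (s := Finset.range (a + 2)) (f := u)
      have h3 := Finset.card_image_le (s := Finset.range (b + 1)) (f := u')
      rw [Finset.card_range] at h2 h3
      omega

/-- the predicate counted by `pendentPathCount` -/
def IsPP (G : SimpleGraph V) (r : ℕ) (u : Fin (r + 1) → V) : Prop :=
    Function.Injective u ∧
    (∀ i : Fin r, G.Adj (u i.castSucc) (u i.succ)) ∧
    G.degree (u 0) = 1 ∧ 2 ≤ G.degree (u (Fin.last r)) ∧
    ∀ i : Fin (r + 1), i ≠ 0 → i ≠ Fin.last r → G.degree (u i) = 2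

theorem IsPP.leg {r : ℕ} {f : Fin (r + 1) → V} (h : IsPP G r f) :
    Leg G r (fun i => f ⟨min i r, by omega⟩) := by
  obtain ⟨h1, h2, h3, h4, h5⟩ := h
  refine ⟨?_, ?_, ?_, ?_, ?_⟩
  · intro i hi
    have := h2 ⟨i, hi⟩
    convert this using 2
    · ext; simp; omega
    · ext; simp; omega
  · intro i j hi hj hij
    have := h1 hij
    simp only [Fin.mk.injEq] at this
    omega
  · convert h3 using 3; simp
  · convert h4 using 3; ext; simp
  · intro i h0 hi
    refine h5 _ ?_ ?_
    · intro he; have := congrArg Fin.val he; simp at this; omega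
    · intro he; have := congrArg Fin.val he; simp at this; omega

theorem Leg.isPP {r : ℕ} {u : ℕ → V} (h : Leg G r u) : IsPP G r (fun i => u i.val) := by
  refine ⟨?_, ?_, ?_, ?_, ?_⟩
  · intro i j hij
    exact Fin.ext (h.inj i j (by omega) (by omega) hij)
  · intro i
    exact h.adj i i.isLt
  · exact h.dzero
  · exact h.dlast
  · intro i h0 h1
    refine h.dmid i ?_ ?_
    · exact Fin.pos_iff_ne_zero.2 h0
    · have := Fin.lt_last_iff_ne_last.2 h1
      exact this

theorem ppc_eq (r : ℕ) : pendentPathCount G r = Nat.card {u // IsPP G r u} := rfl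

theorem exists_legs {r k : ℕ} (h : pendentPathCount G r = k) (hk : 0 < k) :
    ∃ u : Fin k → ℕ → V, (∀ i, Leg G r (u i)) ∧ ∀ i j, u i 0 = u j 0 → i = j := by
  rw [ppc_eq] at h
  have e : {u // IsPP G r u} ≃ Fin k := (Finite.equivFinOfCardEq h)
  refine ⟨fun i t => (e.symm i).1 ⟨min t r, by omega⟩, fun i => (e.symm i).2.leg, ?_⟩
  intro i j hij
  have := (e.symm i).2.leg.ext (e.symm j).2.leg hij
  apply e.symm.injective
  apply Subtype.ext
  funext t
  have := this t (by omega)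
  convert this using 2 <;> (ext; simp; omega)

theorem ppc_of_legs {r k : ℕ} (u : Fin k → ℕ → V) (hu : ∀ i, Leg G r (u i))
    (hinj : ∀ i j, u i 0 = u j 0 → i = j)
    (hsurj : ∀ w, Leg G r w → ∃ i, w 0 = u i 0) : pendentPathCount G r = k := by
  rw [ppc_eq, ← Nat.card_fin k]
  symm
  refine Nat.card_eq_of_bijective
    (fun i => (⟨fun t => u i t.val, (hu i).isPP⟩ : {u // IsPP G r u})) ⟨?_, ?_⟩
  · intro i j hij
    have := congrFun (congrArg Subtype.val hij) 0
    exact hinj i j this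
  · rintro ⟨f, hf⟩
    obtain ⟨i, hi⟩ := hsurj _ hf.leg
    refine ⟨i, ?_⟩
    apply Subtype.ext
    funext t
    have := hf.leg.ext (hu i) hi t (by omega)
    simp only at this ⊢
    rw [← this]
    congr 1
    ext; simp; omega
end legs

section spider
variable {n r k : ℕ}

/-- parent function of the spider -/
def pfun (n r k v : ℕ) : ℕ :=
    if v < n - k * r then 0
    else if (v - (n - k * r)) % r = 0 then 0 else v - 1

theorem srk_adj {a b : Fin n} : (treeSrk n r k).Adj a b ↔
    a ≠ b ∧ (pfun n r k a.val = b.val ∨ pfun n r k b.val = a.val) := Iff.rfl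

theorem leg_bound (i : Fin k) (r : ℕ) : i.val * r + r ≤ k * r := by
  have := Nat.mul_le_mul_right r (Nat.succ_le_of_lt i.isLt)
  rwa [Nat.succ_mul] at this

/-- vertices of the legs of the spider -/
def legV (h : k * r < n) (i : Fin k) (t : ℕ) : Fin n :=
  ⟨if t < r then n - k * r + i.val * r + (r - 1 - t) else 0, by
    have := leg_bound i r
    split_ifs <;> omega⟩

theorem legV_val (h : k * r < n) (i : Fin k) {t : ℕ} (ht : t < r) :
    (legV h i t).val = n - k * r + i.val * r + (r - 1 - t) := by
  simp [legV, ht]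

theorem legV_last (h : k * r < n) (i : Fin k) : (legV h i r).val = 0 := by
  simp [legV]

theorem legV_ge (h : k * r < n) (i : Fin k) {t : ℕ} (ht : t < r) :
    n - k * r ≤ (legV h i t).val := by
  rw [legV_val h i ht]; omega

theorem legV_mod (i t r : ℕ) (ht : t < r) : (i * r + t) % r = t := by
  rw [Nat.add_comm, Nat.add_mul_mod_self_right, Nat.mod_eq_of_lt ht]

theorem legV_div (i t r : ℕ) (ht : t < r) : (i * r + t) / r = i := by
  rw [Nat.add_comm, Nat.add_mul_div_right _ _ (by omega), Nat.div_eq_of_lt ht, Nat.zero_add]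

theorem legV_inj (h : k * r < n) {i j : Fin k} {s t : ℕ} (hs : s < r) (ht : t < r)
    (he : legV h i s = legV h j t) : i = j ∧ s = t := by
  have h1 := congrArg Fin.val he
  rw [legV_val h i hs, legV_val h j ht] at h1
  have h2 : i.val * r + (r - 1 - s) = j.val * r + (r - 1 - t) := by omega
  have h3 := congrArg (· % r) h2
  have h4 := congrArg (· / r) h2
  rw [legV_mod _ _ _ (by omega), legV_mod _ _ _ (by omega)] at h3
  rw [legV_div _ _ _ (by omega), legV_div _ _ _ (by omega)] at h4
  exact ⟨Fin.ext h4, by omega⟩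

theorem exists_legV (h : k * r < n) (hr : 0 < r) (v : Fin n) (hv : n - k * r ≤ v.val) :
    ∃ i t, t < r ∧ v = legV h i t := by
  have h1 : (v.val - (n - k * r)) / r < k := by
    rw [Nat.div_lt_iff_lt_mul hr]; omega
  have h2 := Nat.mod_lt (v.val - (n - k * r)) hr
  refine ⟨⟨_, h1⟩, r - 1 - (v.val - (n - k * r)) % r, by omega, ?_⟩
  ext
  rw [legV_val h _ (by omega)]
  have h3 := Nat.div_add_mod' (v.val - (n - k * r)) r
  simp only
  omega

theorem pfun_legV (h : k * r < n) (i : Fin k) {t : ℕ} (ht : t < r) :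
    pfun n r k (legV h i t).val = (legV h i (t + 1)).val := by
  have h1 := legV_ge h i ht
  have h2 : ((legV h i t).val - (n - k * r)) % r = r - 1 - t := by
    rw [legV_val h i ht, Nat.add_assoc, Nat.add_sub_cancel_left, legV_mod _ _ _ (by omega)]
  unfold pfun
  rw [if_neg (by omega), h2]
  by_cases h3 : t + 1 < r
  · rw [if_neg (by omega), legV_val h i ht, legV_val h i h3]; omega
  · have : t + 1 = r := by omega
    rw [if_pos (by omega), this, legV_last]

theorem pfun_lt {v : ℕ} (h : 0 < v) : pfun n r k v < v := by
  unfold pfun; split_ifs <;> omega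

theorem child_legV (h : k * r < n) (hr : 0 < r) (i : Fin k) {t : ℕ} (ht : t < r) {b : Fin n}
    (hb : pfun n r k b.val = (legV h i t).val) : 0 < t ∧ b = legV h i (t - 1) := by
  have h1 := legV_ge h i ht
  have h2 : n - k * r ≤ b.val := by
    by_contra hcon
    rw [pfun, if_pos (by omega)] at hb
    omega
  obtain ⟨j, s, hs, rfl⟩ := exists_legV h hr b h2
  rw [pfun_legV h j hs] at hb
  by_cases h3 : s + 1 < r
  · obtain ⟨rfl, rfl⟩ := legV_inj h h3 ht (Fin.ext hb)
    exact ⟨by omega, by simp⟩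
  · have : s + 1 = r := by omega
    rw [this, legV_last] at hb
    omega

theorem srk_adj_leg (h : k * r < n) (i : Fin k) {t : ℕ} (ht : t < r) :
    (treeSrk n r k).Adj (legV h i t) (legV h i (t + 1)) := by
  have h1 := pfun_legV h i ht
  refine srk_adj.2 ⟨fun he => ?_, Or.inl h1⟩
  rw [← he] at h1
  have h2 := legV_ge h i ht
  have := pfun_lt (n := n) (r := r) (k := k) (v := (legV h i t).val) (by omega)
  omega

theorem srk_nb_leg (h : k * r < n) (hr : 0 < r) (i : Fin k) {t : ℕ} (ht : t < r) {b : Fin n}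
    (hb : (treeSrk n r k).Adj (legV h i t) b) :
    b = legV h i (t + 1) ∨ (0 < t ∧ b = legV h i (t - 1)) := by
  obtain ⟨-, h1 | h1⟩ := srk_adj.1 hb
  · rw [pfun_legV h i ht] at h1
    exact Or.inl (Fin.ext h1.symm)
  · exact Or.inr (child_legV h hr i ht h1)

theorem srk_deg_zero (h : k * r < n) (hr : 0 < r) (i : Fin k) :
    (treeSrk n r k).degree (legV h i 0) = 1 := by
  rw [← card_neighborFinset_eq_degree, Finset.card_eq_one]
  refine ⟨legV h i 1, ?_⟩
  ext b
  rw [mem_neighborFinset, Finset.mem_singleton]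
  constructor
  · intro hb
    rcases srk_nb_leg h hr i hr hb with h1 | ⟨h1, _⟩
    · exact h1
    · omega
  · rintro rfl
    exact srk_adj_leg h i hr

theorem legV_ne (h : k * r < n) (i : Fin k) {s t : ℕ} (hs : s ≤ r) (ht : t ≤ r) 
    (he : legV h i s = legV h i t) : s = t := by
  by_cases h1 : s < r <;> by_cases h2 : t < r
  · exact (legV_inj h h1 h2 he).2
  · obtain rfl : t = r := by omega
    have := legV_ge h i h1
    rw [he, legV_last] at this
    omega
  · obtain rfl : s = r := by omega
    have := legV_ge h i h2
    rw [← he, legV_last] at this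
    omega
  · omega

theorem srk_deg_mid (h : k * r < n) (i : Fin k) {t : ℕ} (h0 : 0 < t) (ht : t < r) :
    (treeSrk n r k).degree (legV h i t) = 2 := by
  rw [← card_neighborFinset_eq_degree, Finset.card_eq_two]
  refine ⟨legV h i (t + 1), legV h i (t - 1), fun he => ?_, ?_⟩
  · have := legV_ne h i (by omega) (by omega) he
    omega
  ext b
  rw [mem_neighborFinset, Finset.mem_insert, Finset.mem_singleton]
  constructor
  · intro hb
    rcases srk_nb_leg h (by omega) i ht hb with h1 | ⟨_, h1⟩
    · exact Or.inl h1
    · exact Or.inr h1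
  · rintro (rfl | rfl)
    · exact srk_adj_leg h i ht
    · have := srk_adj_leg h i (t := t - 1) (by omega)
      rw [Nat.sub_add_cancel h0] at this
      exact this.symm

theorem srk_adj_zero (h0 : 0 < n) {b : Fin n} (hb : b.val ≠ 0) (hp : pfun n r k b.val = 0) :
    (treeSrk n r k).Adj ⟨0, h0⟩ b :=
  srk_adj.2 ⟨fun he => hb (congrArg Fin.val he).symm, Or.inr hp⟩

theorem srk_deg_center (hr : 2 ≤ r) (hc : (k = 1 ∧ r + 3 ≤ n) ∨ (2 ≤ k ∧ k * r + 2 ≤ n))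
    (h0 : 0 < n) : 3 ≤ (treeSrk n r k).degree ⟨0, h0⟩ := by
  have key : ∀ a b c : Fin n, a.val ≠ 0 → b.val ≠ 0 → c.val ≠ 0 → a ≠ b → a ≠ c → b ≠ c →
      pfun n r k a.val = 0 → pfun n r k b.val = 0 → pfun n r k c.val = 0 →
      3 ≤ (treeSrk n r k).degree ⟨0, h0⟩ := by
    intro a b c ha hb hc hab hac hbc pa pb pc
    rw [← card_neighborFinset_eq_degree, ← Finset.card_eq_three.2 ⟨a, b, c, hab, hac, hbc, rfl⟩]
    refine Finset.card_le_card fun y hy => ?_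
    simp only [Finset.mem_insert, Finset.mem_singleton] at hy
    rw [mem_neighborFinset]
    rcases hy with rfl | rfl | rfl <;> exact srk_adj_zero h0 (by assumption) (by assumption)
  rcases hc with ⟨rfl, hc⟩ | ⟨hk, hc⟩
  · refine key ⟨1, by omega⟩ ⟨2, by omega⟩ ⟨n - r, by omega⟩ (by simp) (by simp) (by simp; omega)
      (by simp) (by simp; omega) (by simp; omega) ?_ ?_ ?_
    · simp [pfun]
    · simp [pfun]; omega
    · simp [pfun]
  · have h2 : 2 * r ≤ k * r := Nat.mul_le_mul_right r hk
    refine key ⟨1, by omega⟩ ⟨n - k * r, by omega⟩ ⟨n - k * r + r, by omega⟩ (by simp)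
      (by simp; omega) (by simp; omega)
      (by simp; omega) (by simp; omega) (by simp; omega) ?_ ?_ ?_
    · simp [pfun]
    · simp [pfun]
    · simp [pfun]

theorem srk_connected (h0 : 0 < n) : (treeSrk n r k).Connected := by
  have key : ∀ m (hm : m < n), (treeSrk n r k).Reachable ⟨m, hm⟩ ⟨0, h0⟩ := by
    intro m
    induction m using Nat.strong_induction_on with
    | _ m ih =>
      intro hm
      rcases Nat.eq_zero_or_pos m with rfl | h1
      · exact Reachable.refl _
      · have h2 := pfun_lt (n := n) (r := r) (k := k) h1
        have h3 : (treeSrk n r k).Adj ⟨m, hm⟩ ⟨pfun n r k m, h2.trans hm⟩ :=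
          srk_adj.2 ⟨fun he => by have := congrArg Fin.val he; simp at this; omega, Or.inl rfl⟩
        exact h3.reachable.trans (ih _ h2 _)
  have : Nonempty (Fin n) := ⟨⟨0, h0⟩⟩
  exact ⟨fun a b => (key a a.isLt).trans (key b b.isLt).symm⟩

theorem pfun_zero (h : k * r < n) : pfun n r k 0 = 0 := by
  unfold pfun; rw [if_pos (by omega)]

theorem srk_isTree (h : k * r < n) : (treeSrk n r k).IsTree := by
  have h0 : 0 < n := by omega
  have hc : (treeSrk n r k).Connected := srk_connected h0
  refine isTree_iff_connected_and_card.2 ⟨hc, le_antisymm ?_ hc.card_vert_le_card_edgeSet_add_one⟩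
  have hsub : (treeSrk n r k).edgeFinset ⊆ ((Finset.univ : Finset (Fin n)).erase ⟨0, h0⟩).image
      (fun v => s(v, (⟨pfun n r k v.val % n, Nat.mod_lt _ h0⟩ : Fin n))) := by
    intro e he
    induction e with | _ a b =>
    rw [mem_edgeFinset, mem_edgeSet] at he
    wlog hp : pfun n r k a.val = b.val generalizing a b
    · rw [Sym2.eq_swap]
      refine this b a he.symm ?_
      rcases (srk_adj.1 he).2 with h1 | h1
      · exact absurd h1 hp
      · exact h1
    rw [Finset.mem_image]
    refine ⟨a, ?_, ?_⟩
    · rw [Finset.mem_erase]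
      refine ⟨?_, Finset.mem_univ _⟩
      rintro rfl
      simp only at hp
      rw [pfun_zero h] at hp
      exact (srk_adj.1 he).1 (Fin.ext hp)
    · congr 2
      rw [hp, Nat.mod_eq_of_lt b.isLt]
  have h1 := (Finset.card_le_card hsub).trans Finset.card_image_le
  rw [Finset.card_erase_of_mem (Finset.mem_univ _), Finset.card_univ, Fintype.card_fin] at h1
  rw [Nat.card_eq_fintype_card, ← edgeFinset_card, Nat.card_eq_fintype_card, Fintype.card_fin]
  omega

theorem legV_last' (h : k * r < n) (i : Fin k) : legV h i r = ⟨0, by omega⟩ :=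
  Fin.ext (legV_last h i)

theorem srk_leg (h : k * r < n) (hr : 2 ≤ r)
    (hc : (k = 1 ∧ r + 3 ≤ n) ∨ (2 ≤ k ∧ k * r + 2 ≤ n)) (i : Fin k) :
    Leg (treeSrk n r k) r (legV h i) where
  adj t ht := srk_adj_leg h i ht
  inj s t hs ht he := legV_ne h i hs ht he
  dzero := srk_deg_zero h (by omega) i
  dlast := by
    rw [legV_last']
    have := srk_deg_center hr hc (by omega)
    omega
  dmid t h0 ht := srk_deg_mid h i h0 ht

theorem srk_ppc (h : k * r < n) (hr : 2 ≤ r)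
    (hc : (k = 1 ∧ r + 3 ≤ n) ∨ (2 ≤ k ∧ k * r + 2 ≤ n)) :
    pendentPathCount (treeSrk n r k) r = k := by
  refine ppc_of_legs (legV h) (srk_leg h hr hc)
    (fun i j hij => (legV_inj h (by omega) (by omega) hij).1) ?_
  intro w hw
  have hcen := srk_deg_center hr hc (show 0 < n by omega)
  by_cases h1 : n - k * r ≤ (w 0).val
  · obtain ⟨i, t, ht, he⟩ := exists_legV h (by omega) (w 0) h1
    refine ⟨i, ?_⟩
    rcases Nat.eq_zero_or_pos t with rfl | h2
    · exact he
    · have h3 := srk_deg_mid h i h2 ht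
      rw [← he, hw.dzero] at h3
      omega
  · exfalso
    by_cases h2 : (w 0).val = 0
    · have h3 : w 0 = ⟨0, by omega⟩ := Fin.ext h2
      rw [← h3, hw.dzero] at hcen
      omega
    · have h3 := srk_adj_zero (r := r) (k := k) (show 0 < n by omega) h2
        (by unfold pfun; rw [if_pos (by omega)])
      have h4 := hw.nb_zero (by omega) h3.symm
      rw [h4, hw.dmid 1 (by omega) (by omega)] at hcen
      omega
end spider

theorem final_iso {n r k : ℕ} (hr : 2 ≤ r) (h : k * r < n)
    (hc : (k = 1 ∧ r + 3 ≤ n) ∨ (2 ≤ k ∧ k * r + 2 ≤ n))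
    (T : SimpleGraph (Fin n)) (hT : T.IsTree) (u : Fin k → ℕ → Fin n)
    (hu : ∀ i, Leg T r (u i)) 
    (hd : ∀ i j a b, a ≤ r → b < r → u i a = u j b → i = j ∧ a = b)
    (c : Fin n) (hcu : ∀ i t, t < r → c ≠ u i t) (h0 : 0 < n)
    (hle : totDist T c ≤ totDist (treeSrk n r k) ⟨0, h0⟩) :
    Nonempty (T ≃g treeSrk n r k) := by
  have hS := srk_isTree h
  -- the bijection
  obtain ⟨φ, hφ0, hφ⟩ : ∃ φ : Fin n ≃ Fin n, φ ⟨0, h0⟩ = c ∧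
      ∀ i t, t < r → φ (legV h i t) = u i t := by
    let f : Fin n → Fin n := fun v =>
      if hv : ∃ i t, t < r ∧ v = legV h i t then u hv.choose hv.choose_spec.choose else c
    have hf : ∀ i t, t < r → f (legV h i t) = u i t := by
      intro i t ht
      have hv : ∃ j s, s < r ∧ legV h i t = legV h j s := ⟨i, t, ht, rfl⟩
      have h1 := hv.choose_spec.choose_spec
      obtain ⟨h2, h3⟩ := legV_inj h ht h1.1 h1.2
      simp only [f]
      rw [dif_pos hv, ← h3, ← h2]
    have hf0 : f ⟨0, h0⟩ = c := by
      simp only [f]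
      rw [dif_neg]
      rintro ⟨i, t, ht, he⟩
      have := legV_ge h i ht
      rw [← he] at this
      simp only at this
      omega
    obtain ⟨g, hg⟩ := Finset.exists_equiv_extend_of_card_eq (α := Fin n) (t := Finset.univ)
      (s := Finset.univ.filter fun v => v = ⟨0, h0⟩ ∨ n - k * r ≤ v.val) (f := f)
      (by simp) (Finset.subset_univ _) (by
        intro a ha b hb hab
        simp only [Finset.coe_filter, Finset.mem_univ, true_and, Set.mem_setOf_eq] at ha hb
        rcases ha with rfl | ha <;> rcases hb with rfl | hb
        · rfl
        · obtain ⟨i, t, ht, rfl⟩ := exists_legV h (by omega) b hb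
          rw [hf0, hf i t ht] at hab
          exact absurd hab (hcu i t ht)
        · obtain ⟨i, t, ht, rfl⟩ := exists_legV h (by omega) a ha
          rw [hf0, hf i t ht] at hab
          exact absurd hab.symm (hcu i t ht)
        · obtain ⟨i, t, ht, rfl⟩ := exists_legV h (by omega) a ha
          obtain ⟨j, s, hs, rfl⟩ := exists_legV h (by omega) b hb
          rw [hf i t ht, hf j s hs] at hab
          obtain ⟨rfl, rfl⟩ := hd i j t s ht.le hs hab
          rfl)
    refine ⟨g.trans (Equiv.subtypeUnivEquiv (fun x => Finset.mem_univ x)), ?_, ?_⟩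
    · have := hg ⟨0, h0⟩ (by simp)
      rw [hf0] at this
      exact this
    · intro i t ht
      have := hg (legV h i t) (Finset.mem_filter.2 ⟨Finset.mem_univ _, Or.inr (legV_ge h i ht)⟩)
      rw [hf i t ht] at this
      exact this
  -- pointwise comparison of distances
  have hpt : ∀ v, (treeSrk n r k).dist ⟨0, h0⟩ v ≤ T.dist c (φ v) := by
    intro v
    by_cases h1 : n - k * r ≤ v.val
    · obtain ⟨i, t, ht, rfl⟩ := exists_legV h (by omega) v h1
      rw [hφ i t ht, (hu i).dist_out hT.connected (hcu i) ht.le,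
        (srk_leg h hr hc i).dist_out hS.connected (fun s hs he => ?_) ht.le, legV_last', SimpleGraph.dist_self]
      · omega
      · have := legV_ge h i hs
        rw [← he] at this
        simp only at this
        omega
    · by_cases h2 : v.val = 0
      · have : v = ⟨0, h0⟩ := Fin.ext h2
        rw [this, SimpleGraph.dist_self]; omega
      · have h3 := srk_adj_zero (r := r) (k := k) h0 h2 (by unfold pfun; rw [if_pos (by omega)])
        rw [dist_eq_one_iff_adj.2 h3]
        apply hT.connected.pos_dist_of_ne
        intro he
        rw [← hφ0] at he
        have := φ.injective he
        rw [← this] at h2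
        exact h2 rfl
  have heq : ∀ v, (treeSrk n r k).dist ⟨0, h0⟩ v = T.dist c (φ v) := by
    by_contra hcon
    push Not at hcon
    obtain ⟨v, hv⟩ := hcon
    have hlt : totDist (treeSrk n r k) ⟨0, h0⟩ < ∑ v, T.dist c (φ v) :=
      Finset.sum_lt_sum (fun v _ => hpt v) ⟨v, Finset.mem_univ _, lt_of_le_of_ne (hpt v) hv⟩
    rw [Equiv.sum_comp φ (fun w => T.dist c w)] at hlt
    exact absurd hle (not_le.2 hlt)
  have hsub : treeSrk n r k ≤ T.comap φ := by
    intro a b hab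
    rw [comap_adj]
    wlog hp : pfun n r k a.val = b.val generalizing a b
    · refine (this hab.symm ?_).symm
      rcases (srk_adj.1 hab).2 with h1 | h1
      · exact absurd h1 hp
      · exact h1
    by_cases hb : b.val = 0
    · obtain rfl : b = ⟨0, h0⟩ := Fin.ext hb
      rw [hφ0]
      have h1 := heq a
      rw [dist_eq_one_iff_adj.2 hab.symm] at h1
      exact (dist_eq_one_iff_adj.1 h1.symm).symm
    · have h1 : n - k * r ≤ a.val := by
        by_contra hcon
        rw [pfun, if_pos (by omega)] at hp
        omega
      obtain ⟨i, t, ht, rfl⟩ := exists_legV h (by omega) a h1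
      rw [pfun_legV h i ht] at hp
      obtain rfl := Fin.ext hp
      have h2 : t + 1 < r := by
        by_contra hcon
        have : t + 1 = r := by omega
        rw [this, legV_last] at hb
        exact hb rfl
      rw [hφ i t ht, hφ i _ h2]
      exact (hu i).adj t ht
  have htree : (T.comap φ).IsTree := (Iso.comap φ T).isTree_iff.2 hT
  have hge := (isTree_iff_minimal_connected.1 htree).2 hS.connected hsub
  have heqG : treeSrk n r k = T.comap φ := le_antisymm hsub hge
  rw [heqG]
  exact ⟨(Iso.comap φ T).symm⟩

/-- the tree maximizing the Mostar index among trees of order n with exactly k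
pendent paths of length r (where k = 1 and 2 ≤ r ≤ n-3, or k ≥ 2, r ≥ 2 and kr ≤ n-2)
is S^r_{n,k}. -/
theorem max_mostar_pendent_paths (n r k : ℕ)
    (hcond : (k = 1 ∧ 2 ≤ r ∧ r ≤ n - 3) ∨ (2 ≤ k ∧ 2 ≤ r ∧ k * r ≤ n - 2))
    (hn : 3 ≤ n)
    (T : SimpleGraph (Fin n)) (hT : T.IsTree) (hpp : pendentPathCount T r = k)
    (hmax : ∀ T' : SimpleGraph (Fin n), T'.IsTree → pendentPathCount T' r = k →
      mostar T' ≤ mostar T) :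
    Nonempty (T ≃g treeSrk n r k) := by
  have hr : 2 ≤ r := by rcases hcond with h | h <;> exact h.2.1
  have hk : 0 < k := by rcases hcond with h | h <;> omega
  have hc : (k = 1 ∧ r + 3 ≤ n) ∨ (2 ≤ k ∧ k * r + 2 ≤ n) := by
    rcases hcond with ⟨h1, h2, h3⟩ | ⟨h1, h2, h3⟩
    · exact Or.inl ⟨h1, by omega⟩
    · exact Or.inr ⟨h1, by omega⟩
  have h : k * r < n := by
    rcases hc with ⟨rfl, h2⟩ | ⟨h1, h2⟩ <;> omega
  have h0 : 0 < n := by omega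
  have hS := srk_isTree h
  obtain ⟨u, hu, huinj⟩ := exists_legs hpp hk
  have hd : ∀ i j a b, a ≤ r → b < r → u i a = u j b → i = j ∧ a = b := by
    intro i j a b ha hb hab
    have hij : i = j := by
      rcases hc with ⟨rfl, h2⟩ | ⟨h1, h2⟩
      · exact Subsingleton.elim _ _
      · have h3 : 2 * r ≤ k * r := Nat.mul_le_mul_right r h1
        exact huinj i j ((hu i).disjoint (hu j) hT.connected
          (by rw [Fintype.card_fin]; omega) (by omega) a b ha hb hab)
    subst hij
    exact ⟨rfl, (hu i).inj a b ha hb.le hab⟩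
  have : Nonempty (Fin n) := ⟨⟨0, h0⟩⟩
  obtain ⟨c, hcmin⟩ := Finite.exists_min (totDist T)
  have hle := trans_le_of_mostar_le hT hS (hmax _ hS (srk_ppc h hr hc)) hcmin
  by_cases hinter : ∃ i t, t < r ∧ c = u i t
  · obtain ⟨i, t, ht, rfl⟩ := hinter
    refine final_iso hr h hc T hT u hu hd (u i r) (fun j s hs he => ?_) h0 ?_
    · have := (hd i j r s le_rfl hs he).2
      omega
    · have h1 := hle (legV h i t)
      have h2 := (hu i).totDist_eq hT.connected ht.le
      have h3 := (srk_leg h hr hc i).totDist_eq hS.connected ht.le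
      rw [legV_last'] at h3
      omega
  · push Not at hinter
    exact final_iso hr h hc T hT u hu hd c hinter h0 (hle _)
end

section
/- Let n, r, a, b be positive integers with a ≥ b+2 and (a+b)r < n−1. Then Mo(A^r_{n,a−1,b+1}) < Mo(A^r_{n,a,b}). -/
open Finset SimpleGraph

open scoped Classical

theorem connected_parentGraph (n : ℕ) (p : ℕ → ℕ) (hn : 0 < n)
    (hp : ∀ v, v ≠ 0 → p v < v) : (parentGraph n p).Connected := by
  have key : ∀ k (hk : k < n), (parentGraph n p).Reachable ⟨k, hk⟩ ⟨0, hn⟩ := by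
    intro k
    induction k using Nat.strong_induction_on with
    | _ k ih =>
      intro hk
      by_cases h0 : k = 0
      · subst h0; exact Reachable.refl _
      · have h1 := hp k h0
        have h2 := ih (p k) h1 (by omega)
        refine Reachable.trans (Adj.reachable ?_) h2
        unfold parentGraph
        rw [SimpleGraph.fromRel_adj]
        refine ⟨?_, Or.inl rfl⟩
        intro h3
        have := congrArg Fin.val h3
        simp at this
        omega
  have : Nonempty (Fin n) := ⟨⟨0, hn⟩⟩
  refine SimpleGraph.Connected.mk ?_
  intro u v
  exact (key u.1 u.2).trans (key v.1 v.2).symm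

theorem dist_lt_of_cut {V : Type*} (G : SimpleGraph V) (hG : G.Connected) (S : Set V) (u v : V)
    (hv : u ∉ S) (hcut : ∀ x y, G.Adj x y → x ∈ S → y ∉ S → x = v ∧ y = u)
    (w : V) (hw : w ∈ S) : G.dist w v < G.dist w u := by
  obtain ⟨q, hq⟩ := hG.exists_walk_length_eq_dist w u
  obtain ⟨d, hd, h1, h2⟩ := q.exists_boundary_dart S hw hv
  obtain ⟨h3, h4⟩ := hcut _ _ d.adj h1 h2
  have hs : v ∈ q.support := h3 ▸ q.dart_fst_mem_support_of_mem_darts hd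
  have hne : v ≠ u := by
    rintro rfl
    exact hv (h3 ▸ h1)
  have := Walk.length_takeUntil_lt_length hs hne
  have := SimpleGraph.dist_le (q.takeUntil v hs)
  omega

theorem mostar_parentGraph (n : ℕ) (p : ℕ → ℕ) (P : ℕ → ℕ → Prop) (hn : 0 < n)
    (hp0 : p 0 = 0) (hp : ∀ v, v ≠ 0 → p v < v)
    (h1 : ∀ v, v ≠ 0 → v < n → P v v) (h2 : ∀ v, v ≠ 0 → v < n → ¬ P v (p v))
    (h3 : ∀ v w, v ≠ 0 → w ≠ 0 → v < n → w < n → w ≠ v → (P v w ↔ P v (p w))) :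
    mostar (parentGraph n p) =
      ∑ v ∈ Finset.Ico 1 n, (2 * (((Finset.range n).filter (P v)).card : ℤ) - n).natAbs := by
  have hG := connected_parentGraph n p hn hp
  have hlt : ∀ v : ℕ, v < n → p v % n < n := fun v _ => Nat.mod_lt _ hn
  let f : ℕ → Sym2 (Fin n) := fun v =>
    s((⟨v % n, Nat.mod_lt _ hn⟩ : Fin n), ⟨p v % n, Nat.mod_lt _ hn⟩)
  have hf : ∀ v, v ∈ Finset.Ico 1 n → ∃ (a : v < n) (b : p v < n), p v < v ∧
      f v = s((⟨v, a⟩ : Fin n), ⟨p v, b⟩) := by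
    intro v hv
    rw [Finset.mem_Ico] at hv
    have := hp v (by omega)
    refine ⟨hv.2, by omega, this, ?_⟩
    simp only [f, Nat.mod_eq_of_lt hv.2, Nat.mod_eq_of_lt (show p v < n by omega)]
  have himg : (parentGraph n p).edgeFinset = (Finset.Ico 1 n).image f := by
    ext e
    rw [SimpleGraph.mem_edgeFinset, Finset.mem_image]
    constructor
    · have aux : ∀ x y : Fin n, x ≠ y → p x.1 = y.1 → ∃ a ∈ Finset.Ico 1 n, f a = s(x, y) := by
        intro x y hxy hpx
        have hx : x.1 ≠ 0 := by
          intro hx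
          apply hxy
          apply Fin.ext
          rw [← hpx, hx, hp0]
        have hm : x.1 ∈ Finset.Ico 1 n := by
          rw [Finset.mem_Ico]; exact ⟨by omega, x.2⟩
        obtain ⟨a, b, c, d⟩ := hf x.1 hm
        refine ⟨x.1, hm, ?_⟩
        rw [d]
        exact congrArg (fun z => s(x, z)) (Fin.ext hpx)
      induction e using Sym2.ind with
      | _ x y =>
        intro he
        rw [SimpleGraph.mem_edgeSet] at he
        unfold parentGraph at he
        rw [SimpleGraph.fromRel_adj] at he
        rcases he with ⟨hne, he | he⟩
        · exact aux x y hne he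
        · obtain ⟨a, ha, hb⟩ := aux y x hne.symm he
          exact ⟨a, ha, hb.trans Sym2.eq_swap⟩
    · rintro ⟨v, hv, rfl⟩
      obtain ⟨a, b, c, d⟩ := hf v hv
      rw [d, SimpleGraph.mem_edgeSet]
      unfold parentGraph
      rw [SimpleGraph.fromRel_adj]
      refine ⟨?_, Or.inl rfl⟩
      intro h
      have := congrArg Fin.val h
      simp at this
      omega
  have hinj : Set.InjOn f (Finset.Ico 1 n : Finset ℕ) := by
    intro v hv w hw hvw
    obtain ⟨a, b, c, d⟩ := hf v hv
    obtain ⟨a2, b2, c2, d2⟩ := hf w hw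
    rw [d, d2, Sym2.eq_iff] at hvw
    simp only [Fin.mk.injEq] at hvw
    omega
  unfold mostar
  rw [himg, Finset.sum_image hinj]
  refine Finset.sum_congr rfl ?_
  intro v hv
  obtain ⟨a, b, c, d⟩ := hf v hv
  have hv0 : v ≠ 0 := by omega
  rw [d]
  let S : Set (Fin n) := {w | P v w.1}
  have hS1 : (⟨v, a⟩ : Fin n) ∈ S := h1 v hv0 a
  have hS2 : (⟨p v, b⟩ : Fin n) ∉ S := h2 v hv0 a
  have hcut : ∀ x y, (parentGraph n p).Adj x y → x ∈ S → y ∉ S →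
      x = ⟨v, a⟩ ∧ y = ⟨p v, b⟩ := by
    intro x y hxy hx hy
    unfold parentGraph at hxy
    rw [SimpleGraph.fromRel_adj] at hxy
    have hxy1 : x.1 ≠ y.1 := fun h => hxy.1 (Fin.ext h)
    have hx' : P v x.1 := hx
    have hy' : ¬ P v y.1 := hy
    rcases hxy.2 with he | he
    · have hx0 : x.1 ≠ 0 := by
        intro h0
        rw [h0, hp0] at he
        omega
      by_cases hxv : x.1 = v
      · refine ⟨Fin.ext hxv, Fin.ext ?_⟩
        simp only
        rw [← he, hxv]
      · have := h3 v x.1 hv0 hx0 a x.2 hxv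
        rw [he] at this
        exact absurd (this.1 hx') hy'
    · have hx0 : y.1 ≠ 0 := by
        intro h0
        rw [h0, hp0] at he
        omega
      by_cases hxv : y.1 = v
      · rw [hxv] at hy'
        exact absurd (h1 v hv0 a) hy'
      · have := h3 v y.1 hv0 hx0 a y.2 hxv
        rw [he] at this
        exact absurd (this.2 hx') hy'
  have hd1 : ∀ w : Fin n, P v w.1 → (parentGraph n p).dist w ⟨v, a⟩ <
      (parentGraph n p).dist w ⟨p v, b⟩ := fun w hw => dist_lt_of_cut _ hG S _ _ hS2 hcut w hw
  have hd2 : ∀ w : Fin n, ¬ P v w.1 → (parentGraph n p).dist w ⟨p v, b⟩ <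
      (parentGraph n p).dist w ⟨v, a⟩ := by
    intro w hw
    refine dist_lt_of_cut _ hG Sᶜ _ _ (fun h => h hS1) ?_ w hw
    intro x y hxy hx hy
    have := hcut y x hxy.symm (not_not.1 hy) hx
    exact ⟨this.2, this.1⟩
  have e1 : (Finset.univ.filter fun w : Fin n => (parentGraph n p).dist w ⟨v, a⟩ <
      (parentGraph n p).dist w ⟨p v, b⟩) = Finset.univ.filter fun w : Fin n => P v w.1 := by
    ext w
    simp only [Finset.mem_filter, Finset.mem_univ, true_and]
    refine ⟨fun h => ?_, hd1 w⟩
    by_contra hc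
    have := hd2 w hc
    omega
  have e2 : (Finset.univ.filter fun w : Fin n => (parentGraph n p).dist w ⟨p v, b⟩ <
      (parentGraph n p).dist w ⟨v, a⟩) = Finset.univ.filter fun w : Fin n => ¬ P v w.1 := by
    ext w
    simp only [Finset.mem_filter, Finset.mem_univ, true_and]
    refine ⟨fun h hc => ?_, hd2 w⟩
    have := hd1 w hc
    omega
  have e3 : (Finset.univ.filter fun w : Fin n => P v w.1).card =
      ((Finset.range n).filter (P v)).card := by
    rw [← Finset.card_map Fin.valEmbedding]
    congr 1
    ext w
    simp only [Finset.mem_map, Finset.mem_filter, Finset.mem_univ, true_and,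
      Finset.mem_range, Fin.valEmbedding_apply]
    constructor
    · rintro ⟨x, hx, rfl⟩
      exact ⟨x.2, hx⟩
    · rintro ⟨hw, hw2⟩
      exact ⟨⟨w, hw⟩, hw2, rfl⟩
  have e4 := Finset.card_filter_add_card_filter_not (s := (Finset.univ : Finset (Fin n)))
    (fun w => P v w.1)
  rw [Finset.card_univ, Fintype.card_fin] at e4
  simp only [mostarPsi, Sym2.lift_mk]
  rw [e1, e2, ← e3]
  omega

theorem mostar_treeA (n r a b m : ℕ) (hr : 1 ≤ r) (hm : 2 ≤ m) (hn : n = m + (a + b) * r) :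
    mostar (treeA n r a b) =
      ∑ v ∈ Finset.Ico 1 m, ((((a : ℤ) - b) * r) + (2 * v - m)).natAbs +
      ∑ v ∈ Finset.Ico m n, (2 * (((Finset.range n).filter
        (fun w => v ≤ w ∧ w < v + (r - (v - m) % r))).card : ℤ) - n).natAbs := by
  have hm1 : n - (a + b) * r = m := by omega
  have hm2 : n - b * r = m + a * r := by
    rw [hn, add_mul]; omega
  have hmod : ∀ v, ¬ v < m + a * r → (v - (m + a * r)) % r = (v - m) % r := by
    intro v hv
    have : v - m = (v - (m + a * r)) + r * a := by rw [mul_comm r a]; omega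
    rw [this, Nat.add_mul_mod_self_left]
  have hfun : treeA n r a b = parentGraph n (fun v => if v < m then v - 1 else
      if (v - m) % r = 0 then (if v < m + a * r then 0 else m - 1) else v - 1) := by
    unfold treeA
    congr 1
    funext v
    rw [hm1, hm2]
    have := hmod v
    split_ifs <;> first | rfl | omega
  have hnm : m + a * r ≤ n := by rw [hn, add_mul]; omega
  rw [hfun, mostar_parentGraph n _ (fun v w => if v < m then (v ≤ w ∧ w < m) ∨ m + a * r ≤ w
    else v ≤ w ∧ w < v + (r - (v - m) % r))]
  · rw [← Finset.sum_Ico_consecutive _ (show 1 ≤ m by omega) (show m ≤ n by omega)]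
    congr 1
    · refine Finset.sum_congr rfl ?_
      intro v hv
      rw [Finset.mem_Ico] at hv
      have hcard : ∀ s : Finset ℕ, (∀ w, w ∈ s ↔ w < n ∧ ((v ≤ w ∧ w < m) ∨ m + a * r ≤ w)) →
          (s.card : ℤ) = (m : ℤ) - v + b * r := by
        intro s hs
        have hc : s = Finset.Ico v m ∪ Finset.Ico (m + a * r) n := by
          ext w
          rw [hs, Finset.mem_union, Finset.mem_Ico, Finset.mem_Ico]
          omega
        have : s.card = (m - v) + b * r := by
          rw [hc, Finset.card_union_of_disjoint, Nat.card_Ico, Nat.card_Ico]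
          · rw [hn, add_mul]; omega
          · rw [Finset.disjoint_left]
            intro w hw hw2
            rw [Finset.mem_Ico] at hw hw2
            omega
        rw [this, Nat.cast_add, Nat.cast_sub hv.2.le, Nat.cast_mul]
      rw [← Int.natAbs_neg]
      congr 1
      rw [hcard _ (by intro w; simp only [Finset.mem_filter, Finset.mem_range, if_pos hv.2]), hn]
      push_cast
      ring
    · refine Finset.sum_congr rfl ?_
      intro v hv
      rw [Finset.mem_Ico] at hv
      have : ¬ v < m := by omega
      simp only [this, if_false]
  · omega
  · simp
    omega
  · intro v hv
    split_ifs <;> omega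
  · intro v hv hvn
    have := Nat.mod_lt (v - m) hr
    split_ifs <;> omega
  · intro v hv hvn
    have h1 := Nat.mod_lt (v - m) hr
    split_ifs <;> omega
  · intro v w hv hw hvn hwn hne
    by_cases hvm : v < m
    · simp only [if_pos hvm]
      by_cases hwm : w < m
      · simp only [if_pos hwm]; omega
      · simp only [if_neg hwm]
        by_cases hwr : (w - m) % r = 0
        · simp only [if_pos hwr]
          split_ifs <;> omega
        · simp only [if_neg hwr]
          have g1 : w ≠ m := by rintro rfl; simp at hwr
          have g2 : w ≠ m + a * r := by rintro rfl; simp at hwr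
          omega
    · simp only [if_neg hvm]
      by_cases hwm : w < m
      · simp only [if_pos hwm]; omega
      · simp only [if_neg hwm]
        have ht := Nat.mod_lt (v - m) hr
        have hq := Nat.div_add_mod (v - m) r
        by_cases hwr : (w - m) % r = 0
        · have hL : ¬ (v ≤ w ∧ w < v + (r - (v - m) % r)) := by
            rintro ⟨g1, g2⟩
            have e : w - m = ((v - m) % r + (w - v)) + r * ((v - m) / r) := by omega
            rw [e, Nat.add_mul_mod_self_left, Nat.mod_eq_of_lt (by omega)] at hwr
            omega
          simp only [if_pos hwr]
          split_ifs <;> omega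
        · simp only [if_neg hwr]
          have g : w ≠ v + (r - (v - m) % r) := by
            intro hw2
            have e : w - m = r + r * ((v - m) / r) := by omega
            rw [e, Nat.add_mul_mod_self_left] at hwr
            simp at hwr
          omega

theorem sum_abs_lt (m : ℕ) (hm : 2 ≤ m) (D E : ℤ) (hE : 0 ≤ E) (hD : E + 2 ≤ D) :
    ∑ v ∈ Finset.Ico 1 m, (E + (2 * v - m)).natAbs <
      ∑ v ∈ Finset.Ico 1 m, (D + (2 * v - m)).natAbs := by
  have refl : ∀ F : ℤ, ∑ v ∈ Finset.Ico 1 m, (F + (2 * v - m)).natAbs =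
      ∑ v ∈ Finset.Ico 1 m, (F - (2 * v - m)).natAbs := by
    intro F
    refine Finset.sum_bij' (fun v _ => m - v) (fun v _ => m - v) ?_ ?_ ?_ ?_ ?_
    all_goals
      intro v hv
      rw [Finset.mem_Ico] at hv
    · rw [Finset.mem_Ico]; omega
    · rw [Finset.mem_Ico]; omega
    · omega
    · omega
    · rw [Nat.cast_sub hv.2.le]; congr 1; ring
  have key : ∑ v ∈ Finset.Ico 1 m, ((E + (2 * v - m)).natAbs + (E - (2 * v - m)).natAbs) <
      ∑ v ∈ Finset.Ico 1 m, ((D + (2 * v - m)).natAbs + (D - (2 * v - m)).natAbs) := by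
    refine Finset.sum_lt_sum ?_ ⟨m / 2, ?_, ?_⟩
    · intro v _; omega
    · rw [Finset.mem_Ico]; omega
    · omega
  rw [Finset.sum_add_distrib, Finset.sum_add_distrib, ← refl, ← refl] at key
  omega

/-- for positive integers n, r, a, b with a ≥ b+2 and (a+b)r < n-1,
Mo(A^r_{n,a-1,b+1}) < Mo(A^r_{n,a,b}). -/
theorem mostar_treeA_lt (n r a b : ℕ) (hn : 1 ≤ n) (hr : 1 ≤ r) (hb : 1 ≤ b)
    (hab : b + 2 ≤ a) (h : (a + b) * r < n - 1) :
    mostar (treeA n r (a - 1) (b + 1)) < mostar (treeA n r a b) := by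
  obtain ⟨c, rfl⟩ : ∃ c, a = c + 1 := ⟨a - 1, by omega⟩
  have hs : c + (b + 1) = c + 1 + b := by omega
  obtain ⟨m, hm⟩ : ∃ m, n = m + (c + 1 + b) * r := ⟨n - (c + 1 + b) * r, by omega⟩
  have hm2 : 2 ≤ m := by omega
  rw [Nat.add_sub_cancel, mostar_treeA n r c (b + 1) m hr hm2 (by rw [hs]; exact hm),
    mostar_treeA n r (c + 1) b m hr hm2 hm]
  apply Nat.add_lt_add_right
  apply sum_abs_lt m hm2
  · apply mul_nonneg
    · push_cast; omega
    · omega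
  · push_cast
    have : (1 : ℤ) ≤ r := by exact_mod_cast hr
    linarith
end
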